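/- arXiv:2201.02169 — 2 statements merged into one kernel-verified Lean document; each statement's English description precedes it below -/
import Mathlib

section
/- Fix ε ≥ 0, δ ∈ (0,1), u > 0 and c > 0. In the contextual linear bandit generative model, for t with A_t positive definite define Z^x_{a,b,ε}(t) = sgn(θ̂_tᵀγ^x_{b,a} + ε) · (θ̂_tᵀγ^x_{b,a} + ε)² / (2 ‖γ^x_{b,a}‖²_{A_t^{-1}}) and the exploration threshold β(δ,t) = (1+u) log( det( (uc)^{-1} A_t + I_d )^{1/2} / δ ). Then, under any sampling rule, ℙ_θ( ∃ t ≥ 1, ∃ x ∈ 𝒳, ∃ a ∈ 𝒜 : A_t ⪰ c I_d, a ∈ 𝒜_ε(θ̂_t, x), min_{b ≠ a} Z^x_{a,b,ε}(t) > β(δ,t), and θᵀ(φ_{x,a*_θ(x)} − φ_{x,a}) > ε ) ≤ δ. In particular, under the stopping rule τ = inf{ t : A_t ⪰ cI_d and for every x, max_{a∈𝒜_ε(θ̂_t,x)} min_{b≠a} Z^x_{a,b,ε}(t) > β(δ,t) } and any recommendation â_τ(x) ∈ argmax_{a∈𝒜_ε(θ̂_τ,x)} min_{b≠a} Z^x_{a,b,ε}(τ),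 one has ℙ_θ( ∃ x ∈ 𝒳 : θᵀ(φ_{x,a*_θ(x)} − φ_{x,â_τ(x)}) > ε and τ < ∞ ) ≤ δ. -/
open MeasureTheory ProbabilityTheory Matrix Finset

noncomputable section

variable {d : ℕ} {𝒳 𝒜 : Type*} [Fintype 𝒳] [Fintype 𝒜] [Nonempty 𝒜]

/-- Optimal value `θᵀ φ_{x, a*_θ(x)} = max_a θᵀ φ_{x,a}` in context `x`. -/
def maxVal (φ : 𝒳 → 𝒜 → Fin d → ℝ) (θ : Fin d → ℝ) (x : 𝒳) : ℝ :=
  ⨆ a : 𝒜, θ ⬝ᵥ φ x a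

/-- Suboptimality gap `θᵀ(φ_{x,a*_θ(x)} − φ_{x,a})`. -/
def gap (φ : 𝒳 → 𝒜 → Fin d → ℝ) (θ : Fin d → ℝ) (x : 𝒳) (a : 𝒜) : ℝ :=
  maxVal φ θ x - θ ⬝ᵥ φ x a

open Classical in
/-- Set `𝒜_ε(θ,x)` of ε-optimal arms (for `ε = 0`, the set of optimal arms). -/
def epsOpt (φ : 𝒳 → 𝒜 → Fin d → ℝ) (ε : ℝ) (θ : Fin d → ℝ) (x : 𝒳) : Set 𝒜 :=
  if ε = 0 then {a | gap φ θ x a = 0} else {a | gap φ θ x a < ε}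

/-- Squared `G`-norm `‖v‖²_G = vᵀ G v`. -/
def normSq {n : ℕ} (G : Matrix (Fin n) (Fin n) ℝ) (v : Fin n → ℝ) : ℝ := v ⬝ᵥ G.mulVec v

/-- One-step Gaussian integral. -/
lemma gauss_step (m w : ℝ) (hw : 0 ≤ w) :
    ∫⁻ x, ENNReal.ofReal (Real.exp ((2 * x * m + x ^ 2 * w - m ^ 2) / (1 + w) / 2) /
      Real.sqrt (1 + w)) ∂(gaussianReal 0 1) = 1 := by
  rw [gaussianReal_of_var_ne_zero 0 one_ne_zero,
    lintegral_withDensity_eq_lintegral_mul _ (measurable_gaussianPDF _ _) (by fun_prop)]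
  obtain ⟨v, hvw⟩ : ∃ v : NNReal, (v : ℝ) = 1 + w := ⟨Real.toNNReal (1 + w),
    Real.coe_toNNReal _ (by linarith)⟩
  have hv : v ≠ 0 := by
    rintro rfl
    rw [NNReal.coe_zero] at hvw
    linarith
  rw [← lintegral_gaussianPDF_eq_one m hv]
  congr 1
  ext x
  simp only [Pi.mul_apply, gaussianPDF_def]
  rw [← ENNReal.ofReal_mul (gaussianPDFReal_nonneg _ _ _)]
  congr 1
  simp only [gaussianPDFReal, NNReal.coe_one, hvw]
  have h1 : (0 : ℝ) < 1 + w := by linarith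
  rw [Real.sqrt_mul (by positivity) (1 + w), mul_one]
  have : Real.exp (-(x - m) ^ 2 / (2 * (1 + w))) = Real.exp (-(x - 0) ^ 2 / (2 * 1)) *
      Real.exp ((2 * x * m + x ^ 2 * w - m ^ 2) / (1 + w) / 2) := by
    rw [← Real.exp_add]
    congr 1
    field_simp
    ring
  rw [this]
  field_simp

/-- One-step identity for the mixture martingale. -/
lemma indep_step {Ω : Type*} {H m0 : MeasurableSpace Ω} {μ : Measure Ω} [IsProbabilityMeasure μ]
    (hH : H ≤ m0) (ξ : Ω → ℝ) (hξ : Measurable ξ)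
    (hd : Measure.map ξ μ = gaussianReal 0 1)
    (hi : Indep (MeasurableSpace.comap ξ inferInstance) H μ)
    (P : Ω → ENNReal) (m w : Ω → ℝ) (hP : Measurable[H] P) (hm : Measurable[H] m)
    (hw : Measurable[H] w) (hw0 : ∀ ω, 0 ≤ w ω) :
    ∫⁻ ω, P ω * ENNReal.ofReal (Real.exp ((2 * ξ ω * m ω + ξ ω ^ 2 * w ω - m ω ^ 2) /
      (1 + w ω) / 2) / Real.sqrt (1 + w ω)) ∂μ = ∫⁻ ω, P ω ∂μ := by
  let Y : Ω → ENNReal × ℝ × ℝ := fun ω => (P ω, m ω, w ω)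
  have hY : Measurable[H] Y := hP.prodMk (hm.prodMk hw)
  have hY0 : Measurable Y := hY.mono hH le_rfl
  have hind : IndepFun Y ξ μ := by
    rw [IndepFun_iff_Indep]
    exact indep_of_indep_of_le_left hi.symm hY.comap_le
  have hmap := (indepFun_iff_map_prod_eq_prod_map_map hY0.aemeasurable hξ.aemeasurable).1 hind
  rw [hd] at hmap
  let f : (ENNReal × ℝ × ℝ) × ℝ → ENNReal := fun z => z.1.1 * ENNReal.ofReal
    (Real.exp ((2 * z.2 * z.1.2.1 + z.2 ^ 2 * z.1.2.2 - z.1.2.1 ^ 2) /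
      (1 + z.1.2.2) / 2) / Real.sqrt (1 + z.1.2.2))
  have hf : Measurable f := by fun_prop
  have h1 : ∫⁻ z, f z ∂(μ.map (fun ω => (Y ω, ξ ω))) = ∫⁻ ω, f (Y ω, ξ ω) ∂μ :=
    lintegral_map hf (hY0.prodMk hξ)
  change ∫⁻ ω, f (Y ω, ξ ω) ∂μ = _
  rw [← h1, hmap, lintegral_prod _ hf.aemeasurable, lintegral_map (by fun_prop) hY0]
  congr 1
  ext ω
  simp only [f]
  rw [lintegral_const_mul _ (by fun_prop), gauss_step _ _ (hw0 ω), mul_one]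

/-- Ville's inequality. -/
lemma ville_ineq {Ω : Type*} {m0 : MeasurableSpace Ω} {μ : Measure Ω} [IsProbabilityMeasure μ]
    (F : ℕ → MeasurableSpace Ω) (hF : ∀ t, F t ≤ m0) (hmono : Monotone F)
    (M : ℕ → Ω → ENNReal) (hM : ∀ t, Measurable[F t] (M t)) (h0 : ∀ ω, M 0 ω = 1)
    (step : ∀ t B, MeasurableSet[F t] B → ∫⁻ ω in B, M (t + 1) ω ∂μ = ∫⁻ ω in B, M t ω ∂μ)
    (K : ENNReal) (hK : 1 ≤ K) : K * μ {ω | ∃ t, K ≤ M t ω} ≤ 1 := by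
  let B : ℕ → Set Ω := fun t => {ω | ∀ s ≤ t, M s ω < K}
  have hBm : ∀ t, MeasurableSet[F t] (B t) := by
    intro t
    have : B t = ⋂ s ∈ Set.Iic t, {ω | M s ω < K} := by ext; simp [B]
    rw [this]
    refine MeasurableSet.biInter (Set.to_countable _) fun s hs => ?_
    exact ((hM s).mono (hmono hs) le_rfl) measurableSet_Iio
  have hBm0 : ∀ t, MeasurableSet (B t) := fun t => hF t _ (hBm t)
  have hM0 : ∀ t, Measurable (M t) := fun t => (hM t).mono (hF t) le_rfl
  have key : ∀ t, K * μ (B t)ᶜ + ∫⁻ ω in B t, M t ω ∂μ ≤ 1 := by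
    intro t
    induction t with
    | zero =>
      by_cases h : 1 < K
      · have : B 0 = Set.univ := by ext; simp [B, h0, h]
        simp [this, h0]
      · have : B 0 = ∅ := by ext; simp [B, h0, h]
        have hK1 : K = 1 := le_antisymm (not_lt.1 h) hK
        simp [this, hK1]
    | succ t ih =>
      refine le_trans ?_ ih
      rw [← step t (B t) (hBm t)]
      have hsub : B (t + 1) ⊆ B t := fun ω h s hs => h s (by omega)
      have hc : (B (t + 1))ᶜ = (B t)ᶜ ∪ (B t \ B (t + 1)) := by
        ext ω
        have := @hsub ω
        simp only [Set.mem_compl_iff, Set.mem_union, Set.mem_sdiff]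
        tauto
      have hdm : MeasurableSet (B t \ B (t + 1)) := (hBm0 t).diff (hBm0 (t + 1))
      have e1 : μ (B (t + 1))ᶜ ≤ μ (B t)ᶜ + μ (B t \ B (t + 1)) := by
        rw [hc]; exact measure_union_le _ _
      have e2 : ∫⁻ ω in B t, M (t + 1) ω ∂μ =
          ∫⁻ ω in B (t + 1), M (t + 1) ω ∂μ + ∫⁻ ω in B t \ B (t + 1), M (t + 1) ω ∂μ := by
        rw [← lintegral_union hdm Set.disjoint_sdiff_right, Set.union_sdiff_cancel hsub]
      have e3 : K * μ (B t \ B (t + 1)) ≤ ∫⁻ ω in B t \ B (t + 1), M (t + 1) ω ∂μ := by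
        rw [← setLIntegral_const]
        refine setLIntegral_mono' hdm fun ω hω => ?_
        by_contra hlt
        push Not at hlt
        refine hω.2 fun s hs => ?_
        rcases Nat.lt_or_ge s (t + 1) with h | h
        · exact hω.1 s (by omega)
        · have : s = t + 1 := le_antisymm hs h
          rw [this]; exact hlt
      rw [e2]
      calc K * μ (B (t + 1))ᶜ + ∫⁻ ω in B (t + 1), M (t + 1) ω ∂μ
          ≤ K * (μ (B t)ᶜ + μ (B t \ B (t + 1))) + ∫⁻ ω in B (t + 1), M (t + 1) ω ∂μ := by gcongr
        _ = K * μ (B t)ᶜ + (∫⁻ ω in B (t + 1), M (t + 1) ω ∂μ + K * μ (B t \ B (t + 1))) := by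
          ring
        _ ≤ _ := by gcongr
  have hU : {ω | ∃ t, K ≤ M t ω} = ⋃ t, (B t)ᶜ := by
    ext ω
    simp only [Set.mem_ofPred_eq, Set.mem_iUnion, Set.mem_compl_iff, B, not_forall, not_lt]
    exact ⟨fun ⟨t, h⟩ => ⟨t, t, le_rfl, h⟩, fun ⟨_, s, _, h⟩ => ⟨s, h⟩⟩
  have hmonoB : Monotone fun t => (B t)ᶜ :=
    fun s t hst => Set.compl_subset_compl.2 fun ω h r hr => h r (hr.trans hst)
  rw [hU, hmonoB.measure_iUnion, ENNReal.mul_iSup]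
  exact iSup_le fun t => le_trans le_self_add (key t)

lemma symm_dot {d : ℕ} {V : Matrix (Fin d) (Fin d) ℝ} (hV : V.IsHermitian) (x y : Fin d → ℝ) :
    x ⬝ᵥ V *ᵥ y = y ⬝ᵥ V *ᵥ x := by
  have h : Vᵀ = V := by
    rw [← conjTranspose_eq_transpose_of_trivial]; exact hV
  rw [dotProduct_mulVec, ← mulVec_transpose, h, dotProduct_comm]

lemma posDef_mul_inv {d : ℕ} {V : Matrix (Fin d) (Fin d) ℝ} (hV : V.PosDef) (x : Fin d → ℝ) :
    V *ᵥ (V⁻¹ *ᵥ x) = x := by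
  rw [mulVec_mulVec, mul_nonsing_inv _ ((isUnit_iff_isUnit_det _).1 hV.isUnit), one_mulVec]

lemma posDef_inv_mul {d : ℕ} {V : Matrix (Fin d) (Fin d) ℝ} (hV : V.PosDef) (x : Fin d → ℝ) :
    V⁻¹ *ᵥ (V *ᵥ x) = x := by
  rw [mulVec_mulVec, nonsing_inv_mul _ ((isUnit_iff_isUnit_det _).1 hV.isUnit), one_mulVec]

lemma normSq_nonneg' {d : ℕ} {V : Matrix (Fin d) (Fin d) ℝ} (hV : V.PosSemidef) (x : Fin d → ℝ) :
    0 ≤ x ⬝ᵥ V *ᵥ x := by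
  simpa using hV.dotProduct_mulVec_nonneg x

lemma det_rank_one {d : ℕ} {V : Matrix (Fin d) (Fin d) ℝ} (hV : V.PosDef) (f : Fin d → ℝ) :
    (V + vecMulVec f f).det = V.det * (1 + f ⬝ᵥ V⁻¹ *ᵥ f) := by
  rw [vecMulVec_eq Unit, det_add_replicateCol_mul_replicateRow
    ((isUnit_iff_isUnit_det _).1 hV.isUnit)]
  congr 1
  rw [det_unique]
  simp only [Matrix.add_apply, Matrix.one_apply_eq, Matrix.mul_assoc]
  congr 1

lemma psd_vv {d : ℕ} (f : Fin d → ℝ) : (vecMulVec f f).PosSemidef := by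
  simpa using posSemidef_vecMulVec_self_star f

lemma quad_rank_one {d : ℕ} {V : Matrix (Fin d) (Fin d) ℝ} (hV : V.PosDef) (f s : Fin d → ℝ)
    (x : ℝ) :
    (s + x • f) ⬝ᵥ (V + vecMulVec f f)⁻¹ *ᵥ (s + x • f) = s ⬝ᵥ V⁻¹ *ᵥ s +
      (2 * x * (f ⬝ᵥ V⁻¹ *ᵥ s) + x ^ 2 * (f ⬝ᵥ V⁻¹ *ᵥ f) - (f ⬝ᵥ V⁻¹ *ᵥ s) ^ 2) /
        (1 + f ⬝ᵥ V⁻¹ *ᵥ f) := by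
  have hV' : (V + vecMulVec f f).PosDef := hV.add_posSemidef (psd_vv f)
  have hw : 0 ≤ f ⬝ᵥ V⁻¹ *ᵥ f := normSq_nonneg' hV.inv.posSemidef f
  have hs : s ⬝ᵥ V⁻¹ *ᵥ f = f ⬝ᵥ V⁻¹ *ᵥ s := symm_dot hV.inv.isHermitian _ _
  set w := f ⬝ᵥ V⁻¹ *ᵥ f with hwd
  set m := f ⬝ᵥ V⁻¹ *ᵥ s with hmd
  have h1 : 1 + w ≠ 0 := by positivity
  have hx : (V + vecMulVec f f) *ᵥ (V⁻¹ *ᵥ s + ((x - m) / (1 + w)) • V⁻¹ *ᵥ f) = s + x • f := by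
    rw [mulVec_add, mulVec_smul, add_mulVec, add_mulVec, posDef_mul_inv hV, posDef_mul_inv hV,
      vecMulVec_mulVec, vecMulVec_mulVec, ← hwd, ← hmd]
    ext i
    simp only [Pi.add_apply, Pi.smul_apply, smul_eq_mul, MulOpposite.smul_eq_mul_unop,
      MulOpposite.unop_op]
    field_simp
    ring
  have hinv : (V + vecMulVec f f)⁻¹ *ᵥ (s + x • f) =
      V⁻¹ *ᵥ s + ((x - m) / (1 + w)) • V⁻¹ *ᵥ f := by
    rw [← hx, posDef_inv_mul hV']
  rw [hinv]
  simp only [dotProduct_add, add_dotProduct, dotProduct_smul, smul_dotProduct, smul_eq_mul, hs,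
    ← hwd, ← hmd]
  field_simp
  ring

lemma quad_compare {d : ℕ} {A : Matrix (Fin d) (Fin d) ℝ} {u c : ℝ} (hu : 0 < u)
    (hA : (A - c • (1 : Matrix (Fin d) (Fin d) ℝ)).PosSemidef) (hAd : A.PosDef)
    (hV : ((u * c) • (1 : Matrix (Fin d) (Fin d) ℝ) + A).PosDef) (s : Fin d → ℝ) :
    s ⬝ᵥ A⁻¹ *ᵥ s ≤
      (1 + u) * (s ⬝ᵥ ((u * c) • (1 : Matrix (Fin d) (Fin d) ℝ) + A)⁻¹ *ᵥ s) := by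
  set V := (u * c) • (1 : Matrix (Fin d) (Fin d) ℝ) + A with hVd
  set h := A⁻¹ *ᵥ s with hh
  set y := V⁻¹ *ᵥ s with hy
  have e1 : A *ᵥ h = s := posDef_mul_inv hAd s
  have e2 : V *ᵥ y = s := posDef_mul_inv hV s
  have e3 := normSq_nonneg' hA h
  have e4 := normSq_nonneg' hV.posSemidef ((1 + u)⁻¹ • h - y)
  have e5 : V *ᵥ h = (u * c) • h + s := by
    rw [hVd, add_mulVec, smul_mulVec, one_mulVec, e1]
  have e6 : y ⬝ᵥ V *ᵥ h = h ⬝ᵥ s := by rw [symm_dot hV.isHermitian, e2]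
  rw [sub_mulVec, smul_mulVec, one_mulVec, e1] at e3
  rw [mulVec_sub, mulVec_smul, e2] at e4
  simp only [dotProduct_sub, sub_dotProduct, dotProduct_smul, smul_dotProduct, smul_eq_mul,
    e6] at e3 e4
  rw [e5, dotProduct_add, dotProduct_smul, smul_eq_mul] at e4
  rw [dotProduct_comm s h, dotProduct_comm s y]
  have h1 : 0 < 1 + u := by linarith
  have e7 : (1 + u)⁻¹ * ((1 + u)⁻¹ * (u * c * (h ⬝ᵥ h) + h ⬝ᵥ s)) ≤ (1 + u)⁻¹ * (h ⬝ᵥ s) := by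
    have : u * c * (h ⬝ᵥ h) + h ⬝ᵥ s ≤ (1 + u) * (h ⬝ᵥ s) := by nlinarith
    have := mul_le_mul_of_nonneg_left this (inv_nonneg.2 h1.le)
    rw [inv_mul_cancel_left₀ h1.ne'] at this
    exact mul_le_mul_of_nonneg_left this (inv_nonneg.2 h1.le)
  have e8 : (1 + u)⁻¹ * (h ⬝ᵥ s) ≤ y ⬝ᵥ s := by linarith
  calc h ⬝ᵥ s = (1 + u) * ((1 + u)⁻¹ * (h ⬝ᵥ s)) := by rw [mul_inv_cancel_left₀ h1.ne']
    _ ≤ _ := by gcongr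

lemma cauchy_A {d : ℕ} {A : Matrix (Fin d) (Fin d) ℝ} (hA : A.PosDef) (s g : Fin d → ℝ) :
    ((A⁻¹ *ᵥ s) ⬝ᵥ g) ^ 2 ≤ (s ⬝ᵥ A⁻¹ *ᵥ s) * (g ⬝ᵥ A⁻¹ *ᵥ g) := by
  have hs : s ⬝ᵥ A⁻¹ *ᵥ g = g ⬝ᵥ A⁻¹ *ᵥ s := symm_dot hA.inv.isHermitian _ _
  have key : ∀ x : ℝ, 0 ≤ (g ⬝ᵥ A⁻¹ *ᵥ g) * (x * x) + (2 * (g ⬝ᵥ A⁻¹ *ᵥ s)) * x +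
      (s ⬝ᵥ A⁻¹ *ᵥ s) := by
    intro x
    have := normSq_nonneg' hA.inv.posSemidef (s + x • g)
    simp only [mulVec_add, mulVec_smul, dotProduct_add, add_dotProduct, dotProduct_smul,
      smul_dotProduct, smul_eq_mul, hs] at this
    nlinarith
  have := discrim_le_zero key
  rw [discrim] at this
  rw [dotProduct_comm]
  nlinarith

lemma meas_det {Ω : Type*} {m : MeasurableSpace Ω} {d : ℕ} {V : Ω → Matrix (Fin d) (Fin d) ℝ}
    (h : ∀ i j, Measurable fun ω => V ω i j) : Measurable fun ω => (V ω).det := by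
  simp_rw [det_apply']
  exact Finset.measurable_fun_sum _ fun σ _ =>
    (Finset.measurable_fun_prod _ fun i _ => h _ _).const_mul _

lemma meas_inv {Ω : Type*} {m : MeasurableSpace Ω} {d : ℕ} {V : Ω → Matrix (Fin d) (Fin d) ℝ}
    (h : ∀ i j, Measurable fun ω => V ω i j) (i j : Fin d) :
    Measurable fun ω => (V ω)⁻¹ i j := by
  simp_rw [Matrix.inv_def, Matrix.smul_apply, smul_eq_mul, Ring.inverse_eq_inv', adjugate_apply]
  refine (meas_det h).inv.mul (meas_det fun k l => ?_)
  simp_rw [updateRow_apply]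
  split_ifs
  · exact measurable_const
  · exact h _ _

lemma meas_quad {Ω : Type*} {m : MeasurableSpace Ω} {d : ℕ} {V : Ω → Matrix (Fin d) (Fin d) ℝ}
    {x y : Ω → Fin d → ℝ} (h : ∀ i j, Measurable fun ω => V ω i j)
    (hx : ∀ i, Measurable fun ω => x ω i) (hy : ∀ i, Measurable fun ω => y ω i) :
    Measurable fun ω => x ω ⬝ᵥ (V ω)⁻¹ *ᵥ y ω := by
  simp only [dotProduct, mulVec]
  exact Finset.measurable_fun_sum _ fun i _ => (hx i).mul <|
    Finset.measurable_fun_sum _ fun j _ => (meas_inv h i j).mul (hy j)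

lemma posDef_V {d : ℕ} {lam : ℝ} (hl : 0 < lam) (f : ℕ → Fin d → ℝ) (t : ℕ) :
    (lam • (1 : Matrix (Fin d) (Fin d) ℝ) +
      ∑ s ∈ Finset.range t, vecMulVec (f s) (f s)).PosDef :=
  (PosDef.one.smul hl).add_posSemidef (posSemidef_sum _ fun s _ => psd_vv (f s))

lemma det_V_ge {d : ℕ} {lam : ℝ} (hl : 0 < lam) (f : ℕ → Fin d → ℝ) (t : ℕ) :
    lam ^ d ≤ (lam • (1 : Matrix (Fin d) (Fin d) ℝ) +
      ∑ s ∈ Finset.range t, vecMulVec (f s) (f s)).det := by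
  induction t with
  | zero => simp
  | succ t ih =>
    have hp := posDef_V hl f t
    rw [Finset.sum_range_succ, ← add_assoc, det_rank_one hp]
    have := normSq_nonneg' hp.inv.posSemidef (f t)
    nlinarith [hp.det_pos]

/-- Self-normalized (method of mixtures) time-uniform bound. -/
lemma mixture_bound {Ω : Type*} {m0 : MeasurableSpace Ω} {μ : Measure Ω} [IsProbabilityMeasure μ]
    {d : ℕ} (F H : ℕ → MeasurableSpace Ω) (hFH : ∀ t, F t ≤ H t) (hHF : ∀ t, H t ≤ F (t + 1))
    (hF : ∀ t, F t ≤ m0) (f : ℕ → Ω → Fin d → ℝ)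
    (hf : ∀ t i, Measurable[H t] fun ω => f t ω i)
    (ξ : ℕ → Ω → ℝ) (hξF : ∀ t, Measurable[F (t + 1)] (ξ t))
    (hd : ∀ t, Measure.map (ξ t) μ = gaussianReal 0 1)
    (hi : ∀ t, Indep (MeasurableSpace.comap (ξ t) inferInstance) (H t) μ)
    {lam δ : ℝ} (hl : 0 < lam) (hδ : δ ∈ Set.Ioo (0 : ℝ) 1) :
    μ {ω | ∃ t, 1 / δ ≤ Real.exp (((∑ s ∈ Finset.range t, ξ s ω • f s ω) ⬝ᵥ
      (lam • (1 : Matrix (Fin d) (Fin d) ℝ) +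
        ∑ s ∈ Finset.range t, vecMulVec (f s ω) (f s ω))⁻¹ *ᵥ
      (∑ s ∈ Finset.range t, ξ s ω • f s ω)) / 2) *
      Real.sqrt (lam ^ d / (lam • (1 : Matrix (Fin d) (Fin d) ℝ) +
        ∑ s ∈ Finset.range t, vecMulVec (f s ω) (f s ω)).det)} ≤ ENNReal.ofReal δ := by
  have hmono : Monotone F := monotone_nat_of_le_succ fun t => (hFH t).trans (hHF t)
  set V : ℕ → Ω → Matrix (Fin d) (Fin d) ℝ := fun t ω => lam • (1 : Matrix (Fin d) (Fin d) ℝ) +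
        ∑ s ∈ Finset.range t, vecMulVec (f s ω) (f s ω) with hV
  set S : ℕ → Ω → Fin d → ℝ := fun t ω => ∑ s ∈ Finset.range t, ξ s ω • f s ω with hS
  have hVp : ∀ t ω, (V t ω).PosDef := fun t ω => posDef_V hl (fun s => f s ω) t
  have hfm : ∀ s t, s < t → ∀ i, Measurable[F t] fun ω => f s ω i := fun s t hst i =>
    (hf s i).mono ((hHF s).trans (hmono hst)) le_rfl
  have hξm : ∀ s t, s < t → Measurable[F t] (ξ s) := fun s t hst =>
    (hξF s).mono (hmono hst) le_rfl
  have hVm : ∀ t i j, Measurable[F t] fun ω => V t ω i j := by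
    intro t i j
    simp only [hV, Matrix.add_apply, Matrix.sum_apply, vecMulVec_apply]
    refine Measurable.const_add (Finset.measurable_fun_sum _ fun s hs => ?_) _
    exact (hfm s t (Finset.mem_range.1 hs) i).mul (hfm s t (Finset.mem_range.1 hs) j)
  have hSm : ∀ t i, Measurable[F t] fun ω => S t ω i := by
    intro t i
    simp only [hS, Finset.sum_apply, Pi.smul_apply, smul_eq_mul]
    refine Finset.measurable_fun_sum _ fun s hs => ?_
    exact (hξm s t (Finset.mem_range.1 hs)).mul (hfm s t (Finset.mem_range.1 hs) i)
  let M : ℕ → Ω → ENNReal := fun t ω => ENNReal.ofReal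
    (Real.exp ((S t ω ⬝ᵥ (V t ω)⁻¹ *ᵥ S t ω) / 2) * Real.sqrt (lam ^ d / (V t ω).det))
  have hMm : ∀ t, Measurable[F t] (M t) := by
    intro t
    have h1 := meas_quad (hVm t) (hSm t) (hSm t)
    have h2 := meas_det (hVm t)
    exact ((h1.div_const 2).exp.mul (h2.const_div _).sqrt).ennreal_ofReal
  have hM0 : ∀ ω, M 0 ω = 1 := by
    intro ω
    have : lam ^ d ≠ 0 := by positivity
    simp [M, hV, hS, this]
  have step : ∀ t B, MeasurableSet[F t] B →
      ∫⁻ ω in B, M (t + 1) ω ∂μ = ∫⁻ ω in B, M t ω ∂μ := by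
    intro t B hB
    have hB0 := hF t _ hB
    rw [← lintegral_indicator hB0, ← lintegral_indicator hB0]
    have hVH : ∀ i j, Measurable[H t] fun ω => V t ω i j :=
      fun i j => (hVm t i j).mono (hFH t) le_rfl
    have hSH : ∀ i, Measurable[H t] fun ω => S t ω i := fun i => (hSm t i).mono (hFH t) le_rfl
    have hPm : Measurable[H t] (B.indicator (M t)) :=
      ((hMm t).indicator hB).mono (hFH t) le_rfl
    rw [← indep_step ((hHF t).trans (hF _)) (ξ t) ((hξF t).mono (hF _) le_rfl) (hd t) (hi t)
      (B.indicator (M t)) (fun ω => f t ω ⬝ᵥ (V t ω)⁻¹ *ᵥ S t ω)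
      (fun ω => f t ω ⬝ᵥ (V t ω)⁻¹ *ᵥ f t ω) hPm (meas_quad hVH (hf t) hSH)
      (meas_quad hVH (hf t) (hf t)) (fun ω => normSq_nonneg' (hVp t ω).inv.posSemidef _)]
    congr 1
    ext ω
    by_cases hω : ω ∈ B
    swap
    · simp [hω]
    simp only [Set.indicator_of_mem hω, M]
    rw [← ENNReal.ofReal_mul (by positivity)]
    congr 1
    have hV1 : V (t + 1) ω = V t ω + vecMulVec (f t ω) (f t ω) := by
      simp only [hV, Finset.sum_range_succ, add_assoc]
    have hS1 : S (t + 1) ω = S t ω + ξ t ω • f t ω := by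
      simp only [hS, Finset.sum_range_succ]
    rw [hV1, hS1, quad_rank_one (hVp t ω), det_rank_one (hVp t ω), add_div, Real.exp_add,
      ← div_div, Real.sqrt_div (div_nonneg (by positivity) (hVp t ω).det_pos.le)]
    ring
  have hδ0 := hδ.1
  have hK : (1 : ENNReal) ≤ ENNReal.ofReal (1 / δ) := by
    rw [ENNReal.one_le_ofReal, le_div_iff₀ hδ0]
    linarith [hδ.2]
  have := ville_ineq F hF hmono M hMm hM0 step (ENNReal.ofReal (1 / δ)) hK
  have hset : {ω | ∃ t, ENNReal.ofReal (1 / δ) ≤ M t ω} = {ω | ∃ t, 1 / δ ≤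
      Real.exp ((S t ω ⬝ᵥ (V t ω)⁻¹ *ᵥ S t ω) / 2) * Real.sqrt (lam ^ d / (V t ω).det)} := by
    ext ω
    simp only [Set.mem_ofPred_eq, M]
    refine exists_congr fun t => ENNReal.ofReal_le_ofReal_iff (by positivity)
  rw [hset] at this
  have h2 := mul_le_mul_right this (ENNReal.ofReal δ)
  rw [← mul_assoc, ← ENNReal.ofReal_mul hδ0.le, mul_one_div_cancel hδ0.ne', ENNReal.ofReal_one,
    one_mul, mul_one] at h2
  exact h2

/-- δ-correctness of the GLR-based stopping and recommendation rules in the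
contextual linear bandit model, under any sampling rule. -/
theorem stmt_13 [Nontrivial 𝒜]
    [MeasurableSpace 𝒳] [MeasurableSingletonClass 𝒳]
    [MeasurableSpace 𝒜] [MeasurableSingletonClass 𝒜]
    {Ω : Type*} [MeasureSpace Ω] [IsProbabilityMeasure (ℙ : Measure Ω)]
    (φ : 𝒳 → 𝒜 → Fin d → ℝ) (θ : Fin d → ℝ)
    (p : Measure 𝒳) [IsProbabilityMeasure p]
    (X : ℕ → Ω → 𝒳) (act : ℕ → Ω → 𝒜) (ξ : ℕ → Ω → ℝ) (r : ℕ → Ω → ℝ)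
    (F : ℕ → MeasurableSpace Ω)
    (hF : ∀ t, F t =
      (⨆ s ∈ Finset.range t, MeasurableSpace.comap (X s) inferInstance) ⊔
      (⨆ s ∈ Finset.range t, MeasurableSpace.comap (act s) inferInstance) ⊔
      (⨆ s ∈ Finset.range t, MeasurableSpace.comap (r s) inferInstance))
    (hXmeas : ∀ t, Measurable (X t)) (hξmeas : ∀ t, Measurable (ξ t))
    (hXdist : ∀ t, Measure.map (X t) ℙ = p)
    (hXindep : ∀ t, Indep (MeasurableSpace.comap (X t) inferInstance) (F t) ℙ)
    (hact : ∀ t, Measurable[F t ⊔ MeasurableSpace.comap (X t) inferInstance] (act t))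
    (hξdist : ∀ t, Measure.map (ξ t) ℙ = gaussianReal 0 1)
    (hξindep : ∀ t, Indep (MeasurableSpace.comap (ξ t) inferInstance)
      (F t ⊔ MeasurableSpace.comap (X t) inferInstance ⊔
        MeasurableSpace.comap (act t) inferInstance) ℙ)
    (hr : ∀ t ω, r t ω = θ ⬝ᵥ φ (X t ω) (act t ω) + ξ t ω)
    (A : ℕ → Ω → Matrix (Fin d) (Fin d) ℝ)
    (hA : ∀ t ω, A t ω =
      ∑ s ∈ Finset.range t, vecMulVec (φ (X s ω) (act s ω)) (φ (X s ω) (act s ω)))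
    (θhat : ℕ → Ω → Fin d → ℝ)
    (hθhat : ∀ t ω, θhat t ω =
      (A t ω)⁻¹.mulVec (∑ s ∈ Finset.range t, r s ω • φ (X s ω) (act s ω)))
    (ε δ u c : ℝ) (hε : 0 ≤ ε) (hδ : δ ∈ Set.Ioo (0 : ℝ) 1) (hu : 0 < u) (hc : 0 < c)
    (Z : ℕ → Ω → 𝒳 → 𝒜 → 𝒜 → ℝ)
    (hZ : ∀ t ω x a b, Z t ω x a b =
      Real.sign (θhat t ω ⬝ᵥ (φ x a - φ x b) + ε) * (θhat t ω ⬝ᵥ (φ x a - φ x b) + ε) ^ 2 /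
        (2 * normSq (A t ω)⁻¹ (φ x a - φ x b)))
    (β : ℕ → Ω → ℝ)
    (hβ : ∀ t ω, β t ω = (1 + u) * Real.log (Real.sqrt (((u * c)⁻¹ • A t ω + 1).det) / δ))
    (S : Ω → Set ℕ)
    (hS : ∀ ω, S ω = {t | 1 ≤ t ∧
      (A t ω - c • (1 : Matrix (Fin d) (Fin d) ℝ)).PosSemidef ∧
      ∀ x, ∃ a ∈ epsOpt φ ε (θhat t ω) x, ∀ b ≠ a, β t ω < Z t ω x a b})
    (ahat : Ω → 𝒳 → 𝒜)
    (hahat : ∀ ω, (S ω).Nonempty → ∀ x,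
      ahat ω x ∈ epsOpt φ ε (θhat (sInf (S ω)) ω) x ∧
      ∀ a ∈ epsOpt φ ε (θhat (sInf (S ω)) ω) x,
        (⨅ b : {b : 𝒜 // b ≠ a}, Z (sInf (S ω)) ω x a b.1) ≤
        ⨅ b : {b : 𝒜 // b ≠ ahat ω x}, Z (sInf (S ω)) ω x (ahat ω x) b.1) :
    ℙ {ω | ∃ t, 1 ≤ t ∧ ∃ x a,
        (A t ω - c • (1 : Matrix (Fin d) (Fin d) ℝ)).PosSemidef ∧
        a ∈ epsOpt φ ε (θhat t ω) x ∧ (∀ b ≠ a, β t ω < Z t ω x a b) ∧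
        ε < gap φ θ x a} ≤ ENNReal.ofReal δ ∧
    ℙ {ω | (S ω).Nonempty ∧ ∃ x, ε < gap φ θ x (ahat ω x)} ≤ ENNReal.ofReal δ := by
  have hlam : 0 < u * c := mul_pos hu hc
  -- sub-σ-algebras
  let H : ℕ → MeasurableSpace Ω := fun t => F t ⊔ MeasurableSpace.comap (X t) inferInstance ⊔
        MeasurableSpace.comap (act t) inferInstance
  have hXF : ∀ s t, s < t → MeasurableSpace.comap (X s) inferInstance ≤ F t := by
    intro s t hst
    rw [hF t]
    exact le_sup_of_le_left (le_sup_of_le_left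
      (le_iSup₂_of_le s (Finset.mem_range.2 hst) le_rfl))
  have haF : ∀ s t, s < t → MeasurableSpace.comap (act s) inferInstance ≤ F t := by
    intro s t hst
    rw [hF t]
    exact le_sup_of_le_left (le_sup_of_le_right
      (le_iSup₂_of_le s (Finset.mem_range.2 hst) le_rfl))
  have hrF : ∀ s t, s < t → MeasurableSpace.comap (r s) inferInstance ≤ F t := by
    intro s t hst
    rw [hF t]
    exact le_sup_of_le_right (le_iSup₂_of_le s (Finset.mem_range.2 hst) le_rfl)
  have hFmono : ∀ t, F t ≤ F (t + 1) := by
    intro t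
    conv_lhs => rw [hF t]
    refine sup_le (sup_le ?_ ?_) ?_
    · exact iSup₂_le fun s hs => hXF s _ (by have := Finset.mem_range.1 hs; omega)
    · exact iSup₂_le fun s hs => haF s _ (by have := Finset.mem_range.1 hs; omega)
    · exact iSup₂_le fun s hs => hrF s _ (by have := Finset.mem_range.1 hs; omega)
  have hFH : ∀ t, F t ≤ H t := fun t => le_sup_of_le_left le_sup_left
  have hHF : ∀ t, H t ≤ F (t + 1) := fun t =>
    sup_le (sup_le (hFmono t) (hXF t _ (Nat.lt_succ_self t))) (haF t _ (Nat.lt_succ_self t))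
  have hXH : ∀ t, Measurable[H t] (X t) := fun t =>
    measurable_iff_comap_le.2 (le_sup_of_le_left le_sup_right)
  have haH : ∀ t, Measurable[H t] (act t) := fun t => measurable_iff_comap_le.2 le_sup_right
  have hphi : ∀ (m : MeasurableSpace Ω) t, Measurable[m] (X t) → Measurable[m] (act t) →
      ∀ g : 𝒳 × 𝒜 → ℝ, Measurable[m] fun ω => g (X t ω, act t ω) := by
    intro m t h1 h2 g
    exact (measurable_of_finite g).comp (h1.prodMk h2)
  have hFm : ∀ t, F t ≤ (MeasureSpace.toMeasurableSpace : MeasurableSpace Ω) := by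
    intro t
    induction t with
    | zero => rw [hF 0]; simp
    | succ t ih =>
      have hat : Measurable (act t) :=
        (hact t).mono (sup_le ih (measurable_iff_comap_le.1 (hXmeas t))) le_rfl
      have hrt : Measurable (r t) := by
        have : r t = fun ω => θ ⬝ᵥ φ (X t ω) (act t ω) + ξ t ω := funext (hr t)
        rw [this]
        exact (hphi _ t (hXmeas t) hat (fun z => θ ⬝ᵥ φ z.1 z.2)).add (hξmeas t)
      have ih' := ih
      rw [hF t] at ih'
      have i1 := le_sup_left.trans (le_sup_left.trans ih')
      have i2 := le_sup_right.trans (le_sup_left.trans ih')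
      have i3 := le_sup_right.trans ih'
      rw [hF (t + 1)]
      refine sup_le (sup_le ?_ ?_) ?_
      · exact iSup₂_le fun s _ => measurable_iff_comap_le.1 (hXmeas s)
      · refine iSup₂_le fun s hs => ?_
        rcases (Finset.mem_range_succ_iff.1 hs).lt_or_eq with h | h
        · exact le_trans (le_iSup₂_of_le s (Finset.mem_range.2 h) le_rfl) i2
        · subst h; exact measurable_iff_comap_le.1 hat
      · refine iSup₂_le fun s hs => ?_
        rcases (Finset.mem_range_succ_iff.1 hs).lt_or_eq with h | h
        · exact le_trans (le_iSup₂_of_le s (Finset.mem_range.2 h) le_rfl) i3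
        · subst h; exact measurable_iff_comap_le.1 hrt
  have hξF : ∀ t, Measurable[F (t + 1)] (ξ t) := by
    intro t
    have : ξ t = fun ω => r t ω - θ ⬝ᵥ φ (X t ω) (act t ω) := by
      ext ω; rw [hr t ω]; ring
    rw [this]
    exact (measurable_iff_comap_le.2 (hrF t _ (Nat.lt_succ_self t))).sub
      (hphi _ t ((hXH t).mono (hHF t) le_rfl) ((haH t).mono (hHF t) le_rfl)
        (fun z => θ ⬝ᵥ φ z.1 z.2))
  have hmix := mixture_bound (μ := (ℙ : Measure Ω)) F H hFH hHF hFm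
    (fun t ω => φ (X t ω) (act t ω))
    (fun t i => hphi _ t (hXH t) (haH t) (fun z => φ z.1 z.2 i)) ξ hξF hξdist hξindep hlam hδ
  -- pathwise analysis
  have hfirst : ℙ {ω | ∃ t, 1 ≤ t ∧ ∃ x a,
        (A t ω - c • (1 : Matrix (Fin d) (Fin d) ℝ)).PosSemidef ∧
        a ∈ epsOpt φ ε (θhat t ω) x ∧ (∀ b ≠ a, β t ω < Z t ω x a b) ∧
        ε < gap φ θ x a} ≤ ENNReal.ofReal δ := by
    refine (measure_mono ?_).trans hmix
    rintro ω ⟨t, -, x, a, hpsd, -, hZb, hgap⟩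
    refine ⟨t, ?_⟩
    have hVp := posDef_V hlam (fun s => φ (X s ω) (act s ω)) t
    have hDge := det_V_ge hlam (fun s => φ (X s ω) (act s ω)) t
    simp only [← hA t ω] at hVp hDge ⊢
    set sv : Fin d → ℝ := ∑ s ∈ Finset.range t, ξ s ω • φ (X s ω) (act s ω) with hsv
    set q := sv ⬝ᵥ ((u * c) • (1 : Matrix (Fin d) (Fin d) ℝ) + A t ω)⁻¹ *ᵥ sv with hq
    have hAd : (A t ω).PosDef := by
      have : A t ω = c • (1 : Matrix (Fin d) (Fin d) ℝ) +
        (A t ω - c • (1 : Matrix (Fin d) (Fin d) ℝ)) := by abel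
      rw [this]
      exact (PosDef.one.smul hc).add_posSemidef hpsd
    have hcmp : sv ⬝ᵥ (A t ω)⁻¹ *ᵥ sv ≤ (1 + u) * q := quad_compare hu hpsd hAd hVp sv
    have hld : 0 < (u * c) ^ d := by positivity
    have hdet : ((u * c)⁻¹ • A t ω + 1).det =
        ((u * c) • (1 : Matrix (Fin d) (Fin d) ℝ) + A t ω).det / (u * c) ^ d := by
      have : (u * c) • (1 : Matrix (Fin d) (Fin d) ℝ) + A t ω =
          (u * c) • ((u * c)⁻¹ • A t ω + 1) := by
        rw [smul_add, smul_smul, mul_inv_cancel₀ hlam.ne', one_smul, add_comm]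
      rw [this, det_smul, Fintype.card_fin]
      field_simp
    set D := ((u * c) • (1 : Matrix (Fin d) (Fin d) ℝ) + A t ω).det with hD
    have hDpos : 0 < D := lt_of_lt_of_le hld hDge
    have hD1 : 1 ≤ D / (u * c) ^ d := (one_le_div hld).2 hDge
    have hδ0 := hδ.1
    have hβt := hβ t ω
    rw [hdet] at hβt
    have hsq1 : 1 ≤ Real.sqrt (D / (u * c) ^ d) := Real.one_le_sqrt.2 hD1
    have hβpos : 0 < β t ω := by
      rw [hβt]
      refine mul_pos (by linarith) (Real.log_pos ?_)
      rw [lt_div_iff₀ hδ0]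
      linarith [hδ.2]
    -- best arm
    obtain ⟨b, hb⟩ : ∃ b, θ ⬝ᵥ φ x b = maxVal φ θ x :=
      exists_eq_ciSup_of_finite (f := fun a => θ ⬝ᵥ φ x a)
    rw [gap, ← hb] at hgap
    have hba : b ≠ a := by rintro rfl; simp at hgap; linarith
    have hz := hZb b hba
    rw [hZ] at hz
    set g := φ x a - φ x b with hg
    set y := θhat t ω ⬝ᵥ g + ε with hy
    have hθ : θhat t ω = θ + (A t ω)⁻¹ *ᵥ sv := by
      rw [hθhat]
      have : ∑ s ∈ Finset.range t, r s ω • φ (X s ω) (act s ω) = A t ω *ᵥ θ + sv := by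
        rw [hA, hsv, sum_mulVec, ← Finset.sum_add_distrib]
        refine Finset.sum_congr rfl fun s _ => ?_
        rw [hr, vecMulVec_mulVec, add_smul, dotProduct_comm]
        rw [op_smul_eq_smul]
      rw [this, mulVec_add, posDef_inv_mul hAd]
    have hn0 : 0 ≤ normSq (A t ω)⁻¹ g := normSq_nonneg' hAd.inv.posSemidef g
    have hpos := hβpos.trans hz
    have hn : 0 < normSq (A t ω)⁻¹ g := by
      rcases hn0.lt_or_eq with h | h
      · exact h
      · rw [← h] at hpos; simp at hpos
    have hypos : 0 < y := by
      rcases lt_trichotomy y 0 with h | h | h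
      · rw [Real.sign_of_neg h] at hpos
        have : -1 * y ^ 2 / (2 * normSq (A t ω)⁻¹ g) ≤ 0 :=
          div_nonpos_of_nonpos_of_nonneg (by nlinarith [sq_nonneg y]) (by positivity)
        linarith
      · rw [h] at hpos; simp at hpos
      · exact h
    rw [Real.sign_of_pos hypos, one_mul, lt_div_iff₀ (by positivity)] at hz
    have hyle : y ≤ ((A t ω)⁻¹ *ᵥ sv) ⬝ᵥ g := by
      rw [hy, hθ, add_dotProduct, hg, dotProduct_sub θ]
      linarith
    have hcs := cauchy_A hAd sv g
    change _ ≤ _ * normSq (A t ω)⁻¹ g at hcs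
    have hy2 : y ^ 2 ≤ (((A t ω)⁻¹ *ᵥ sv) ⬝ᵥ g) ^ 2 := by gcongr
    have h3 : β t ω * 2 * normSq (A t ω)⁻¹ g <
        (sv ⬝ᵥ (A t ω)⁻¹ *ᵥ sv) * normSq (A t ω)⁻¹ g := by linarith
    have h4 := lt_of_mul_lt_mul_right h3 hn0
    have h5 : Real.log (Real.sqrt (D / (u * c) ^ d) / δ) < q / 2 := by
      have : (1 + u) * Real.log (Real.sqrt (D / (u * c) ^ d) / δ) < (1 + u) * (q / 2) := by
        linarith
      exact lt_of_mul_lt_mul_left this (by linarith)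
    have hsqpos : 0 < Real.sqrt (D / (u * c) ^ d) := by linarith
    rw [Real.log_lt_iff_lt_exp (by positivity)] at h5
    have h6 : Real.sqrt ((u * c) ^ d / D) = (Real.sqrt (D / (u * c) ^ d))⁻¹ := by
      rw [← Real.sqrt_inv, inv_div]
    rw [h6, ← div_eq_mul_inv, le_div_iff₀ hsqpos, div_mul_eq_mul_div, one_mul]
    exact h5.le
  refine ⟨hfirst, (measure_mono ?_).trans hfirst⟩
  rintro ω ⟨hne, x, hx⟩
  have hmem := Nat.sInf_mem hne
  obtain ⟨h1, h2⟩ := hahat ω hne x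
  set τ := sInf (S ω) with hτ
  rw [hS ω] at hmem
  obtain ⟨ht1, hpsd, hall⟩ := hmem
  refine ⟨τ, ht1, x, ahat ω x, hpsd, h1, ?_, hx⟩
  obtain ⟨a, ha, hab⟩ := hall x
  have h3 := h2 a ha
  intro b hb
  obtain ⟨b0, hb0⟩ := exists_ne a
  have : Nonempty {b : 𝒜 // b ≠ a} := ⟨⟨b0, hb0⟩⟩
  obtain ⟨b1, hb1⟩ := exists_eq_ciInf_of_finite (f := fun b : {b : 𝒜 // b ≠ a} => Z τ ω x a b.1)
  have h4 : (⨅ b : {b : 𝒜 // b ≠ ahat ω x}, Z τ ω x (ahat ω x) b.1) ≤ Z τ ω x (ahat ω x) b :=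
    ciInf_le (Set.finite_range fun b : {b : 𝒜 // b ≠ ahat ω x} =>
      Z τ ω x (ahat ω x) b.1).bddBelow ⟨b, hb⟩
  have h5 := hab b1.1 b1.2
  rw [← hb1] at h3
  linarith

end
end

section
/- Fix ε ≥ 0, δ ∈ (0,1), u > 0 and c > 0. Let U be a linear subspace of ℝ^d of dimension r and let P be the r×d matrix whose rows form an orthonormal basis of U. In the contextual linear bandit generative model with θ ∈ U, for t with P A_t Pᵀ positive definite define θ̂_{U,t} = (P A_t Pᵀ)^{-1} P (∑_{s=1}^t φ_{x_s,a_s} r_s), the statistic Z^x_{U,a,b,ε}(t) = sgn( θ̂_{U,t}ᵀ (P γ^x_{b,a}) + ε ) · ( θ̂_{U,t}ᵀ (P γ^x_{b,a}) + ε )² / ( 2 ‖P γ^x_{b,a}‖²_{(P A_t Pᵀ)^{-1}} ), and the threshold β_U(δ,t) = (1+u) log( det( (uc)^{-1} P A_t Pᵀ + I_r )^{1/2} / δ ). Then, under any sampling rule, for the stopping rule τ = inf{ t : P A_t Pᵀ ⪰ c I_r and for every x, max_{a∈𝒜_ε(θ̂_{U,t},x)} min_{b≠a} Z^x_{U,a,b,ε}(t)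 > β_U(δ,t) } and any recommendation â_τ(x) ∈ argmax_{a∈𝒜_ε(θ̂_{U,τ},x)} min_{b≠a} Z^x_{U,a,b,ε}(τ), one has ℙ_θ( ∃ x ∈ 𝒳 : θᵀ(φ_{x,a*_θ(x)} − φ_{x,â_τ(x)}) > ε and τ < ∞ ) ≤ δ. -/
open MeasureTheory ProbabilityTheory Matrix Finset

noncomputable section

variable {d : ℕ} {𝒳 𝒜 : Type*} [Fintype 𝒳] [Fintype 𝒜] [Nonempty 𝒜]

lemma aux_gauss (s q : ℝ) (hq : 0 ≤ q) :
    ∫⁻ x, ENNReal.ofReal (Real.exp ((2 * x * s + x ^ 2 * q - s ^ 2) / (2 * (1 + q)))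
      / Real.sqrt (1 + q)) ∂(gaussianReal 0 1) = 1 := by
  have h1 : (0:ℝ) < 1 + q := by linarith
  obtain ⟨v, hvq⟩ : ∃ v : NNReal, (v : ℝ) = 1 + q := ⟨(1 + q).toNNReal, Real.coe_toNNReal _ h1.le⟩
  have hv : v ≠ 0 := by
    intro h
    rw [h, NNReal.coe_zero] at hvq
    linarith
  rw [gaussianReal_of_var_ne_zero _ one_ne_zero,
    lintegral_withDensity_eq_lintegral_mul _ (measurable_gaussianPDF 0 1) (by fun_prop)]
  rw [← lintegral_gaussianPDF_eq_one s hv]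
  refine lintegral_congr fun x => ?_
  simp only [Pi.mul_apply, gaussianPDF, gaussianPDFReal]
  rw [← ENNReal.ofReal_mul (by positivity)]
  congr 1
  rw [hvq, NNReal.coe_one]
  have e : Real.exp (-(x - s) ^ 2 / (2 * (1 + q))) = Real.exp (-(x - 0) ^ 2 / (2 * 1)) *
    Real.exp ((2 * x * s + x ^ 2 * q - s ^ 2) / (2 * (1 + q))) := by
    rw [← Real.exp_add]; congr 1; field_simp; ring
  rw [e]
  have : Real.sqrt (1+q) ≠ 0 := by positivity
  simp
  field_simp
  rw [Real.sqrt_mul (by positivity), Real.sqrt_mul (by positivity)]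
  ring

lemma aux_ville {Ω : Type*} [m0 : MeasurableSpace Ω] (μ : Measure Ω) [IsProbabilityMeasure μ]
    (F : ℕ → MeasurableSpace Ω) (hF : ∀ n, F n ≤ m0) (hmono : ∀ n, F n ≤ F (n + 1))
    (M : ℕ → Ω → ENNReal) (hM : ∀ n, Measurable[F n] (M n)) (hM0 : ∀ ω, M 0 ω ≤ 1)
    (step : ∀ n B, MeasurableSet[F n] B → ∫⁻ ω in B, M (n + 1) ω ∂μ ≤ ∫⁻ ω in B, M n ω ∂μ)
    (K : ENNReal) : K * μ {ω | ∃ n, K ≤ M n ω} ≤ 1 := by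
  let E : ℕ → Set Ω := fun n => {ω | ∃ k ≤ n, K ≤ M k ω}
  have hFm : Monotone F := monotone_nat_of_le_succ hmono
  have hE : ∀ n, MeasurableSet[F n] (E n) := by
    intro n
    have : E n = ⋃ k, ⋃ (_ : k ≤ n), {ω | K ≤ M k ω} := by ext; simp [E]
    rw [this]
    refine MeasurableSet.iUnion fun k => MeasurableSet.iUnion fun hk => ?_
    exact hFm hk _ (hM k measurableSet_Ici)
  have hE' : ∀ n, MeasurableSet (E n) := fun n => hF n _ (hE n)
  have hMm : ∀ n, Measurable (M n) := fun n => (hM n).mono (hF n) le_rfl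
  have key : ∀ n, K * μ (E n) + ∫⁻ ω in (E n)ᶜ, M n ω ∂μ ≤ 1 := by
    intro n
    induction n with
    | zero =>
      calc _ ≤ ∫⁻ ω in E 0, M 0 ω ∂μ + ∫⁻ ω in (E 0)ᶜ, M 0 ω ∂μ := by
            gcongr
            rw [← setLIntegral_const]
            refine setLIntegral_mono (hMm 0) ?_
            rintro ω ⟨k, hk, h⟩
            obtain rfl : k = 0 := by omega
            exact h
        _ = ∫⁻ ω, M 0 ω ∂μ := lintegral_add_compl _ (hE' 0)
        _ ≤ ∫⁻ ω, 1 ∂μ := lintegral_mono hM0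
        _ = 1 := by simp
    | succ n ih =>
      refine le_trans ?_ ih
      have hsub : E n ⊆ E (n + 1) := fun ω ⟨k, hk, h⟩ => ⟨k, by omega, h⟩
      have h1 : μ (E (n + 1)) = μ (E n) + μ (E (n+1) \ E n) := by
        rw [measure_sdiff hsub (hE' n).nullMeasurableSet (measure_ne_top _ _)]
        exact (add_tsub_cancel_of_le (measure_mono hsub)).symm
      have h2 : ∫⁻ ω in (E n)ᶜ, M (n+1) ω ∂μ =
          ∫⁻ ω in (E (n+1) \ E n), M (n+1) ω ∂μ + ∫⁻ ω in (E (n+1))ᶜ, M (n+1) ω ∂μ := by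
        rw [← lintegral_union (hE' _).compl]
        · congr 2
          ext ω
          have := @hsub ω
          simp only [Set.mem_compl_iff, Set.mem_union, Set.mem_sdiff]
          tauto
        · rw [Set.disjoint_left]; rintro ω ⟨h, _⟩ h'; exact h' h
      calc _ = K * μ (E n) + (K * μ (E (n+1) \ E n)
              + ∫⁻ ω in (E (n+1))ᶜ, M (n+1) ω ∂μ) := by rw [h1, mul_add, add_assoc]
        _ ≤ K * μ (E n) + ∫⁻ ω in (E n)ᶜ, M (n+1) ω ∂μ := by
            rw [h2]
            gcongr
            rw [← setLIntegral_const]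
            refine setLIntegral_mono (hMm _) ?_
            rintro ω ⟨⟨k, hk, h⟩, h'⟩
            rcases Nat.lt_or_ge k (n+1) with hk' | hk'
            · exact absurd ⟨k, by omega, h⟩ h'
            · obtain rfl : k = n + 1 := by omega
              exact h
        _ ≤ _ := by
            exact add_le_add le_rfl (step n _ (hE n).compl)
  have hU : {ω | ∃ n, K ≤ M n ω} = ⋃ n, E n := by
    ext ω
    simp only [Set.mem_ofPred_eq, Set.mem_iUnion, E]
    exact ⟨fun ⟨n, h⟩ => ⟨n, n, le_rfl, h⟩, fun ⟨_, k, _, h⟩ => ⟨k, h⟩⟩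
  have hmE : Monotone E := fun a b hab ω ⟨k, hk, h⟩ => ⟨k, hk.trans hab, h⟩
  rw [hU, hmE.measure_iUnion, ENNReal.mul_iSup]
  exact iSup_le fun n => le_trans le_self_add (key n)

lemma aux_symm {n : ℕ} {G : Matrix (Fin n) (Fin n) ℝ} (h : G.IsHermitian) (v w : Fin n → ℝ) :
    v ⬝ᵥ G *ᵥ w = w ⬝ᵥ G *ᵥ v := by
  have h' : Gᵀ = G := by simpa [conjTranspose_eq_transpose_of_trivial] using h.eq
  rw [dotProduct_mulVec, ← mulVec_transpose, h', dotProduct_comm]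

lemma aux_inv_mulVec {n : ℕ} {W : Matrix (Fin n) (Fin n) ℝ} (hW : W.PosDef) (v : Fin n → ℝ) :
    W *ᵥ (W⁻¹ *ᵥ v) = v := by
  rw [mulVec_mulVec, mul_nonsing_inv _ ((isUnit_iff_isUnit_det _).1 hW.isUnit), one_mulVec]

lemma aux_nonneg {n : ℕ} {W : Matrix (Fin n) (Fin n) ℝ} (hW : W.PosSemidef) (v : Fin n → ℝ) :
    0 ≤ v ⬝ᵥ W *ᵥ v := by
  simpa using hW.dotProduct_mulVec_nonneg v

lemma aux_pos {n : ℕ} {W : Matrix (Fin n) (Fin n) ℝ} (hW : W.PosDef) (v : Fin n → ℝ) (hv : v ≠ 0) :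
    0 < v ⬝ᵥ W *ᵥ v := by
  simpa using hW.dotProduct_mulVec_pos hv

lemma aux_var {n : ℕ} {W : Matrix (Fin n) (Fin n) ℝ} (hW : W.PosDef) (S y : Fin n → ℝ) :
    2 * (S ⬝ᵥ y) ≤ normSq W⁻¹ S + normSq W y := by
  have h := aux_nonneg hW.posSemidef (y - W⁻¹ *ᵥ S)
  have e := aux_inv_mulVec hW S
  rw [mulVec_sub, e, sub_dotProduct, dotProduct_sub, dotProduct_sub,
    aux_symm hW.isHermitian (W⁻¹ *ᵥ S) y, e, dotProduct_comm (W⁻¹ *ᵥ S) S, dotProduct_comm y S] at h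
  unfold normSq
  linarith

lemma aux_cs {n : ℕ} {W : Matrix (Fin n) (Fin n) ℝ} (hW : W.PosDef) (w e : Fin n → ℝ) (hw : w ≠ 0) :
    0 < normSq W⁻¹ w ∧ (e ⬝ᵥ w) ^ 2 ≤ normSq W e * normSq W⁻¹ w := by
  have hb : 0 < normSq W⁻¹ w := aux_pos hW.inv w hw
  refine ⟨hb, ?_⟩
  have h := aux_var hW (((e ⬝ᵥ w) / normSq W⁻¹ w) • w) e
  have e1 : normSq W⁻¹ (((e ⬝ᵥ w) / normSq W⁻¹ w) • w) = (e ⬝ᵥ w) ^ 2 / normSq W⁻¹ w := by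
    conv_lhs => unfold normSq
    rw [mulVec_smul, dotProduct_smul, smul_dotProduct]
    change _ * (_ * normSq W⁻¹ w) = _
    change _ / normSq W⁻¹ w * (_ / normSq W⁻¹ w * _) = _
    field_simp
  rw [e1, smul_dotProduct, dotProduct_comm w e, smul_eq_mul] at h
  have e2 : (e ⬝ᵥ w) / normSq W⁻¹ w * (e ⬝ᵥ w) = (e ⬝ᵥ w) ^ 2 / normSq W⁻¹ w := by ring
  rw [e2] at h
  rw [← div_le_iff₀ hb]
  linarith

lemma aux_posDef {n : ℕ} {V : Matrix (Fin n) (Fin n) ℝ} (hV : V.PosSemidef) {l : ℝ} (hl : 0 < l) :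
    (V + l • (1 : Matrix (Fin n) (Fin n) ℝ)).PosDef :=
  PosDef.posSemidef_add hV (PosDef.one.smul hl)

lemma aux_compare {n : ℕ} {V : Matrix (Fin n) (Fin n) ℝ} {u c : ℝ} (hu : 0 < u) (hc : 0 < c)
    (hV : (V - c • (1 : Matrix (Fin n) (Fin n) ℝ)).PosSemidef) (S : Fin n → ℝ) :
    V.PosDef ∧ normSq V⁻¹ S ≤ (1 + u) * normSq (V + (u * c) • (1 : Matrix (Fin n) (Fin n) ℝ))⁻¹ S := by
  have hVp : V.PosDef := by
    have := aux_posDef hV hc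
    simpa using this
  refine ⟨hVp, ?_⟩
  have hW := aux_posDef hVp.posSemidef (mul_pos hu hc)
  have h := aux_var hW S ((1 + u)⁻¹ • (V⁻¹ *ᵥ S))
  have h0 := aux_nonneg hV (V⁻¹ *ᵥ S)
  have e := aux_inv_mulVec hVp S
  rw [sub_mulVec, e, smul_mulVec, one_mulVec, dotProduct_sub, dotProduct_smul,
    dotProduct_comm _ S, smul_eq_mul] at h0
  generalize normSq (V + (u * c) • (1 : Matrix (Fin n) (Fin n) ℝ))⁻¹ S = R at *
  unfold normSq at *
  rw [add_mulVec, mulVec_smul, e, smul_mulVec, one_mulVec, dotProduct_add, dotProduct_smul,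
    smul_dotProduct, smul_dotProduct, dotProduct_smul, dotProduct_comm _ S,
    dotProduct_smul, dotProduct_smul] at h
  simp only [smul_eq_mul] at h
  generalize S ⬝ᵥ V⁻¹ *ᵥ S = a at *
  generalize V⁻¹ *ᵥ S ⬝ᵥ V⁻¹ *ᵥ S = b at *
  have hk : (1 + u)⁻¹ * (1 + u) = 1 := inv_mul_cancel₀ (by positivity)
  have hkp : 0 < (1 + u)⁻¹ := by positivity
  generalize (1 + u)⁻¹ = k at *
  have h3 : k * k * u * (c * b) ≤ k * k * u * a := by
    apply mul_le_mul_of_nonneg_left _ (by positivity); linarith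
  have h5 : k * k * (1 + u) * a = k * a := by rw [mul_assoc k k, hk]; ring
  have h4 : k * a ≤ R := by nlinarith
  have h6 : (1 + u) * (k * a) ≤ (1 + u) * R := mul_le_mul_of_nonneg_left h4 (by positivity)
  have h7 : (1 + u) * (k * a) = a := by rw [← mul_assoc, mul_comm (1+u) k, hk, one_mul]
  linarith

lemma aux_rank1 {n : ℕ} (z : Fin n → ℝ) : (vecMulVec z z).PosSemidef := by
  simpa using posSemidef_vecMulVec_self_star z

lemma aux_det {n : ℕ} {W : Matrix (Fin n) (Fin n) ℝ} (hW : W.PosDef) (z : Fin n → ℝ) :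
    (W + vecMulVec z z).det = W.det * (1 + normSq W⁻¹ z) := by
  rw [vecMulVec_eq Unit, det_add_replicateCol_mul_replicateRow
    ((isUnit_iff_isUnit_det _).1 hW.isUnit)]
  congr 1
  rw [Matrix.mul_assoc, det_unique, ← replicateCol_mulVec, Matrix.add_apply, Matrix.one_apply_eq,
    replicateRow_mul_replicateCol_apply]
  rfl

lemma aux_sm {n : ℕ} {W : Matrix (Fin n) (Fin n) ℝ} (hW : W.PosDef) (z S : Fin n → ℝ) (x : ℝ) :
    normSq (W + vecMulVec z z)⁻¹ (S + x • z) = normSq W⁻¹ S +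
      (2 * x * (z ⬝ᵥ W⁻¹ *ᵥ S) + x ^ 2 * normSq W⁻¹ z - (z ⬝ᵥ W⁻¹ *ᵥ S) ^ 2) /
        (1 + normSq W⁻¹ z) := by
  have hW' : (W + vecMulVec z z).PosDef := hW.add_posSemidef (aux_rank1 z)
  have hq : 0 ≤ normSq W⁻¹ z := aux_nonneg hW.inv.posSemidef z
  set q := normSq W⁻¹ z with hqd
  set s := z ⬝ᵥ W⁻¹ *ᵥ S with hs
  have hs' : S ⬝ᵥ W⁻¹ *ᵥ z = s := aux_symm hW.inv.isHermitian _ _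
  have hv : (W + vecMulVec z z) *ᵥ (W⁻¹ *ᵥ S + ((x - s) / (1 + q)) • (W⁻¹ *ᵥ z)) = S + x • z := by
    rw [add_mulVec, mulVec_add, mulVec_smul, aux_inv_mulVec hW, aux_inv_mulVec hW,
      vecMulVec_mulVec, dotProduct_add, dotProduct_smul]
    change _ + MulOpposite.op (s + _ • q) • z = _
    ext i
    simp
    field_simp
    ring
  have hv2 : (W + vecMulVec z z)⁻¹ *ᵥ (S + x • z) =
      W⁻¹ *ᵥ S + ((x - s) / (1 + q)) • (W⁻¹ *ᵥ z) := by
    rw [← hv, mulVec_mulVec, nonsing_inv_mul _ ((isUnit_iff_isUnit_det _).1 hW'.isUnit), one_mulVec]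
  conv_lhs => unfold normSq
  rw [hv2, dotProduct_add, add_dotProduct, add_dotProduct, dotProduct_smul, dotProduct_smul,
    smul_dotProduct, smul_dotProduct, hs', ← hs]
  change normSq W⁻¹ S + x • s + ((x - s) / (1 + q) * s + (x - s) / (1 + q) * (x * q)) = _
  simp only [smul_eq_mul]
  field_simp
  ring

lemma aux_meas_det {Ω : Type*} [MeasurableSpace Ω] {k : ℕ} (W : Ω → Matrix (Fin k) (Fin k) ℝ)
    (hW : ∀ i j, Measurable fun ω => W ω i j) : Measurable fun ω => (W ω).det := by
  simp only [det_apply]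
  refine Finset.measurable_fun_sum _ fun σ _ => ?_
  refine Measurable.const_smul ?_ _
  exact Finset.measurable_fun_prod _ fun i _ => hW _ _

lemma aux_meas_inv {Ω : Type*} [MeasurableSpace Ω] {k : ℕ} (W : Ω → Matrix (Fin k) (Fin k) ℝ)
    (hW : ∀ i j, Measurable fun ω => W ω i j) (i j : Fin k) :
    Measurable fun ω => (W ω)⁻¹ i j := by
  simp only [Matrix.inv_def, Ring.inverse_eq_inv', Matrix.smul_apply, smul_eq_mul, adjugate_apply]
  refine (aux_meas_det W hW).inv.mul (aux_meas_det _ fun a b => ?_)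
  simp only [updateRow_apply]
  split_ifs
  · exact measurable_const
  · exact hW _ _

lemma aux_meas_bil {Ω : Type*} [MeasurableSpace Ω] {k : ℕ} (W : Ω → Matrix (Fin k) (Fin k) ℝ)
    (hW : ∀ i j, Measurable fun ω => W ω i j) (a b : Ω → Fin k → ℝ)
    (ha : ∀ i, Measurable fun ω => a ω i) (hb : ∀ i, Measurable fun ω => b ω i) :
    Measurable fun ω => a ω ⬝ᵥ (W ω)⁻¹ *ᵥ b ω := by
  simp only [dotProduct, mulVec]
  refine Finset.measurable_fun_sum _ fun i _ => (ha i).mul ?_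
  exact Finset.measurable_fun_sum _ fun j _ => (aux_meas_inv W hW i j).mul (hb j)

/-- the self-normalised process, as a function of the design matrix and the noise vector -/
noncomputable def auxM {k : ℕ} (l : ℝ) (V : Matrix (Fin k) (Fin k) ℝ) (S : Fin k → ℝ) : ℝ :=
  Real.exp (normSq (V + l • (1 : Matrix (Fin k) (Fin k) ℝ))⁻¹ S / 2) / Real.sqrt ((l⁻¹ • V + 1).det)

lemma aux_meas_M {Ω : Type*} [MeasurableSpace Ω] {k : ℕ} (l : ℝ)
    (V : Ω → Matrix (Fin k) (Fin k) ℝ)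
    (hV : ∀ i j, Measurable fun ω => V ω i j) (b : Ω → Fin k → ℝ)
    (hb : ∀ i, Measurable fun ω => b ω i) :
    Measurable fun ω => auxM l (V ω) (b ω) := by
  unfold auxM normSq
  refine Measurable.div ?_ ?_
  · refine Real.measurable_exp.comp (Measurable.div_const (aux_meas_bil _ ?_ b b hb hb) _)
    intro i j
    simp only [Matrix.add_apply]
    exact (hV i j).add measurable_const
  · refine Real.continuous_sqrt.measurable.comp (aux_meas_det _ ?_)
    intro i j
    simp only [Matrix.add_apply, Matrix.smul_apply]
    exact ((hV i j).const_mul l⁻¹).add measurable_const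

lemma aux_det_step {k : ℕ} {l : ℝ} (hl : 0 < l) {V : Matrix (Fin k) (Fin k) ℝ}
    (hV : V.PosSemidef) (z : Fin k → ℝ) :
    (l⁻¹ • (V + vecMulVec z z) + 1).det = (l⁻¹ • V + 1).det *
      (1 + normSq (V + l • (1 : Matrix (Fin k) (Fin k) ℝ))⁻¹ z) := by
  have e : ∀ V : Matrix (Fin k) (Fin k) ℝ, l⁻¹ • V + 1 =
      l⁻¹ • (V + l • (1 : Matrix (Fin k) (Fin k) ℝ)) := by
    intro V
    rw [smul_add, smul_smul, inv_mul_cancel₀ hl.ne', one_smul]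
  rw [e, e, det_smul, det_smul, mul_assoc, ← aux_det (aux_posDef hV hl), add_right_comm]

lemma aux_M_step {k : ℕ} {l : ℝ} (hl : 0 < l) {V : Matrix (Fin k) (Fin k) ℝ}
    (hV : V.PosSemidef) (z S : Fin k → ℝ) (x s q : ℝ)
    (hq : q = z ⬝ᵥ (V + l • (1 : Matrix (Fin k) (Fin k) ℝ))⁻¹ *ᵥ z)
    (hs : s = z ⬝ᵥ (V + l • (1 : Matrix (Fin k) (Fin k) ℝ))⁻¹ *ᵥ S) (hD : 0 ≤ (l⁻¹ • V + 1).det) :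
    auxM l (V + vecMulVec z z) (S + x • z) = auxM l V S *
      (Real.exp ((2 * x * s + x ^ 2 * q - s ^ 2) / (2 * (1 + q))) / Real.sqrt (1 + q)) := by
  unfold auxM
  rw [aux_det_step hl hV, add_right_comm V, aux_sm (aux_posDef hV hl), ← hs]
  change Real.exp ((_ + (_ + _ * (z ⬝ᵥ (V + l • (1 : Matrix (Fin k) (Fin k) ℝ))⁻¹ *ᵥ z) - _) /
    (_ + (z ⬝ᵥ (V + l • (1 : Matrix (Fin k) (Fin k) ℝ))⁻¹ *ᵥ z))) / 2) /
    Real.sqrt (_ * (_ + (z ⬝ᵥ (V + l • (1 : Matrix (Fin k) (Fin k) ℝ))⁻¹ *ᵥ z))) = _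
  rw [← hq, Real.sqrt_mul hD, add_div, Real.exp_add, div_div _ _ (2 : ℝ), mul_comm (1 + q) 2]
  ring

lemma aux_V {k : ℕ} (z : ℕ → Fin k → ℝ) (n : ℕ) :
    (∑ s ∈ range n, vecMulVec (z s) (z s)).PosSemidef :=
  posSemidef_sum _ fun s _ => aux_rank1 (z s)

lemma aux_det_ge {k : ℕ} {l : ℝ} (hl : 0 < l) (z : ℕ → Fin k → ℝ) (n : ℕ) :
    1 ≤ (l⁻¹ • (∑ s ∈ range n, vecMulVec (z s) (z s)) + 1).det := by
  induction n with
  | zero => simp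
  | succ n ih =>
    rw [Finset.sum_range_succ, aux_det_step hl (aux_V z n)]
    have : 0 ≤ normSq ((∑ s ∈ range n, vecMulVec (z s) (z s)) +
        l • (1 : Matrix (Fin k) (Fin k) ℝ))⁻¹ (z n) :=
      aux_nonneg (aux_posDef (aux_V z n) hl).inv.posSemidef _
    nlinarith

lemma aux_indep {Ω : Type*} (G : MeasurableSpace Ω) [m0 : MeasurableSpace Ω] (μ : Measure Ω)
    [IsProbabilityMeasure μ] (hG : G ≤ m0) (ξ : Ω → ℝ) (hξ : Measurable ξ)
    (hd : Measure.map ξ μ = gaussianReal 0 1)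
    (hi : Indep (MeasurableSpace.comap ξ inferInstance) G μ)
    (a : Ω → ENNReal) (q s : Ω → ℝ) (ha : Measurable[G] a) (hq : Measurable[G] q)
    (hs : Measurable[G] s) (hq0 : ∀ ω, 0 ≤ q ω) :
    ∫⁻ ω, a ω * ENNReal.ofReal (Real.exp ((2 * ξ ω * s ω + ξ ω ^ 2 * q ω - s ω ^ 2) /
      (2 * (1 + q ω))) / Real.sqrt (1 + q ω)) ∂μ = ∫⁻ ω, a ω ∂μ := by
  let Y : Ω → ENNReal × ℝ × ℝ := fun ω => (a ω, q ω, s ω)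
  have hY : Measurable[G] Y := ha.prodMk (hq.prodMk hs)
  have hY' : Measurable Y := hY.mono hG le_rfl
  have hind : IndepFun Y ξ μ := by
    rw [IndepFun_iff_Indep]
    exact (indep_of_indep_of_le_right hi hY.comap_le).symm
  have hmap := (indepFun_iff_map_prod_eq_prod_map_map hY'.aemeasurable hξ.aemeasurable).1 hind
  let g : (ENNReal × ℝ × ℝ) × ℝ → ENNReal := fun p => p.1.1 *
    ENNReal.ofReal (Real.exp ((2 * p.2 * p.1.2.2 + p.2 ^ 2 * p.1.2.1 - p.1.2.2 ^ 2) /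
      (2 * (1 + p.1.2.1))) / Real.sqrt (1 + p.1.2.1))
  have hg : Measurable g := by fun_prop
  calc _ = ∫⁻ ω, g (Y ω, ξ ω) ∂μ := rfl
    _ = ∫⁻ p, g p ∂(μ.map fun ω => (Y ω, ξ ω)) := (lintegral_map hg (hY'.prodMk hξ)).symm
    _ = ∫⁻ y, ∫⁻ x, g (y, x) ∂(gaussianReal 0 1) ∂(μ.map Y) := by
        rw [hmap, hd, lintegral_prod _ hg.aemeasurable]
    _ = ∫⁻ ω, ∫⁻ x, g (Y ω, x) ∂(gaussianReal 0 1) ∂μ :=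
        lintegral_map hg.lintegral_prod_right' hY'
    _ = _ := by
        refine lintegral_congr fun ω => ?_
        simp only [g, Y]
        rw [lintegral_const_mul _ (by fun_prop), aux_gauss _ _ (hq0 ω), mul_one]

theorem aux_main {Ω : Type*} [m0 : MeasurableSpace Ω] (μ : Measure Ω) [IsProbabilityMeasure μ]
    (F G : ℕ → MeasurableSpace Ω) (hmono : ∀ n, F n ≤ F (n + 1)) (hFG : ∀ n, F n ≤ G n)
    (hG : ∀ n, G n ≤ m0) {k : ℕ} (ξ : ℕ → Ω → ℝ) (z : ℕ → Ω → Fin k → ℝ)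
    (hzG : ∀ n i, Measurable[G n] fun ω => z n ω i)
    (hzF : ∀ n i, Measurable[F (n + 1)] fun ω => z n ω i)
    (hξF : ∀ n, Measurable[F (n + 1)] (ξ n))
    (hd : ∀ n, Measure.map (ξ n) μ = gaussianReal 0 1)
    (hi : ∀ n, Indep (MeasurableSpace.comap (ξ n) inferInstance) (G n) μ)
    (l δ : ℝ) (hl : 0 < l) (hδ : 0 < δ) :
    μ {ω | ∃ n, δ⁻¹ ≤ auxM l (∑ s ∈ range n, vecMulVec (z s ω) (z s ω))
      (∑ s ∈ range n, ξ s ω • z s ω)} ≤ ENNReal.ofReal δ := by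
  have hFm : Monotone F := monotone_nat_of_le_succ hmono
  set V : ℕ → Ω → Matrix (Fin k) (Fin k) ℝ := fun n ω => ∑ s ∈ range n, vecMulVec (z s ω) (z s ω)
    with hVd
  set S : ℕ → Ω → Fin k → ℝ := fun n ω => ∑ s ∈ range n, ξ s ω • z s ω with hSd
  have hVm : ∀ n i j, Measurable[F n] fun ω => V n ω i j := by
    intro n i j
    simp only [hVd, Matrix.sum_apply, vecMulVec_apply]
    refine Finset.measurable_fun_sum _ fun s hs => ?_
    have hs' := hFm (Finset.mem_range.1 hs : s + 1 ≤ n)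
    exact ((hzF s i).mono hs' le_rfl).mul ((hzF s j).mono hs' le_rfl)
  have hSm : ∀ n i, Measurable[F n] fun ω => S n ω i := by
    intro n i
    simp only [hSd, Finset.sum_apply, Pi.smul_apply, smul_eq_mul]
    refine Finset.measurable_fun_sum _ fun s hs => ?_
    have hs' := hFm (Finset.mem_range.1 hs : s + 1 ≤ n)
    exact ((hξF s).mono hs' le_rfl).mul ((hzF s i).mono hs' le_rfl)
  have hVp : ∀ n ω, (V n ω).PosSemidef := fun n ω => aux_V (fun s => z s ω) n
  have hMm : ∀ n, Measurable[F n] fun ω => auxM l (V n ω) (S n ω) := fun n =>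
    @aux_meas_M _ (F n) _ l (V n) (hVm n) (S n) (hSm n)
  have hWm : ∀ n i j, Measurable[G n] fun ω => (V n ω + l • (1 : Matrix (Fin k) (Fin k) ℝ)) i j := by
    intro n i j
    simp only [Matrix.add_apply]
    exact ((hVm n i j).mono (hFG n) le_rfl).add measurable_const
  have hv := aux_ville μ F (fun n => (hFG n).trans (hG n)) hmono
    (fun n ω => ENNReal.ofReal (auxM l (V n ω) (S n ω)))
    (fun n => ENNReal.measurable_ofReal.comp (hMm n))
    (by intro ω; simp [auxM, hVd, hSd, normSq]) ?_ (ENNReal.ofReal δ⁻¹)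
  · have hsub : {ω | ∃ n, δ⁻¹ ≤ auxM l (V n ω) (S n ω)} ⊆
        {ω | ∃ n, ENNReal.ofReal δ⁻¹ ≤ ENNReal.ofReal (auxM l (V n ω) (S n ω))} :=
      fun ω ⟨n, h⟩ => ⟨n, ENNReal.ofReal_le_ofReal h⟩
    refine (measure_mono hsub).trans ?_
    rw [ENNReal.ofReal_inv_of_pos hδ] at hv ⊢
    calc _ = ENNReal.ofReal δ * ((ENNReal.ofReal δ)⁻¹ * _) := by
          rw [← mul_assoc, ENNReal.mul_inv_cancel (by simpa using hδ) ENNReal.ofReal_ne_top, one_mul]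
      _ ≤ ENNReal.ofReal δ * 1 := mul_le_mul' le_rfl hv
      _ = _ := mul_one _
  · intro n B hB
    have hB' : MeasurableSet B := hG n _ (hFG n _ hB)
    let q : Ω → ℝ := fun ω => z n ω ⬝ᵥ (V n ω + l • (1 : Matrix (Fin k) (Fin k) ℝ))⁻¹ *ᵥ z n ω
    let s : Ω → ℝ := fun ω => z n ω ⬝ᵥ (V n ω + l • (1 : Matrix (Fin k) (Fin k) ℝ))⁻¹ *ᵥ S n ω
    have hqm : Measurable[G n] q := @aux_meas_bil _ (G n) _ _ (hWm n) _ _ (hzG n) (hzG n)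
    have hsm : Measurable[G n] s := @aux_meas_bil _ (G n) _ _ (hWm n) _ _ (hzG n)
      (fun i => (hSm n i).mono (hFG n) le_rfl)
    have ham : Measurable[G n] (B.indicator fun ω => ENNReal.ofReal (auxM l (V n ω) (S n ω))) :=
      Measurable.indicator ((ENNReal.measurable_ofReal.comp (hMm n)).mono (hFG n) le_rfl)
        (hFG n _ hB)
    have hξm : Measurable (ξ n) := (hξF n).mono ((hFG _).trans (hG _)) le_rfl
    have := aux_indep (G n) μ (hG n) (ξ n) hξm (hd n) (hi n) _ q s ham hqm hsm
      (fun ω => aux_nonneg (aux_posDef (hVp n ω) hl).inv.posSemidef _)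
    rw [← lintegral_indicator hB', ← lintegral_indicator hB', ← this]
    refine le_of_eq (lintegral_congr fun ω => ?_)
    by_cases hω : ω ∈ B
    · simp only [Set.indicator_of_mem hω]
      rw [← ENNReal.ofReal_mul (by unfold auxM; positivity)]
      congr 1
      have hD := aux_det_ge hl (fun s => z s ω) n
      rw [← aux_M_step hl (hVp n ω) (z n ω) (S n ω) (ξ n ω) (s ω) (q ω) rfl rfl (by
        simp only [hVd]; linarith)]
      simp only [hVd, hSd, Finset.sum_range_succ]
    · simp [Set.indicator_of_notMem hω]

lemma aux_event {k : ℕ} {V : Matrix (Fin k) (Fin k) ℝ} {u c ε δ : ℝ} (hu : 0 < u) (hc : 0 < c)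
    (hε : 0 ≤ ε) (hδ : δ ∈ Set.Ioo (0 : ℝ) 1)
    (hV : (V - c • (1 : Matrix (Fin k) (Fin k) ℝ)).PosSemidef)
    (hD : 1 ≤ ((u * c)⁻¹ • V + 1).det) (η S w : Fin k → ℝ)
    (hw : η ⬝ᵥ w + ε < 0)
    (hZ : (1 + u) * Real.log (Real.sqrt (((u * c)⁻¹ • V + 1).det) / δ) <
      Real.sign ((V⁻¹ *ᵥ (V *ᵥ η + S)) ⬝ᵥ w + ε) * ((V⁻¹ *ᵥ (V *ᵥ η + S)) ⬝ᵥ w + ε) ^ 2 /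
        (2 * normSq V⁻¹ w)) :
    δ⁻¹ ≤ auxM (u * c) V S := by
  obtain ⟨hVp, hcmp⟩ := aux_compare hu hc hV S
  have hw0 : w ≠ 0 := by
    rintro rfl
    simp at hw
    linarith
  have hth : V⁻¹ *ᵥ (V *ᵥ η + S) = η + V⁻¹ *ᵥ S := by
    rw [mulVec_add, mulVec_mulVec, nonsing_inv_mul _ ((isUnit_iff_isUnit_det _).1 hVp.isUnit),
      one_mulVec]
  rw [hth, add_dotProduct] at hZ
  obtain ⟨hb, hcs⟩ := aux_cs hVp w (V⁻¹ *ᵥ S) hw0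
  have hnn : normSq V (V⁻¹ *ᵥ S) = normSq V⁻¹ S := by
    unfold normSq
    rw [aux_inv_mulVec hVp, dotProduct_comm]
  rw [hnn] at hcs
  set D := ((u * c)⁻¹ • V + 1).det with hDd
  have hsD : 1 ≤ Real.sqrt D := Real.one_le_sqrt.2 hD
  have hpos : 0 < Real.sqrt D / δ := div_pos (by linarith) hδ.1
  have hlog : 0 < Real.log (Real.sqrt D / δ) := by
    apply Real.log_pos
    rw [one_lt_div hδ.1]
    linarith [hδ.2]
  set m := V⁻¹ *ᵥ S ⬝ᵥ w with hm
  set v := η ⬝ᵥ w + m + ε with hv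
  have hβ : 0 < (1 + u) * Real.log (Real.sqrt D / δ) := by positivity
  have hv0 : 0 < v := by
    by_contra hcon
    push Not at hcon
    have : Real.sign v * v ^ 2 / (2 * normSq V⁻¹ w) ≤ 0 := by
      apply div_nonpos_of_nonpos_of_nonneg _ (by positivity)
      apply mul_nonpos_of_nonpos_of_nonneg _ (by positivity)
      rcases hcon.lt_or_eq with h | h
      · rw [Real.sign_of_neg h]; norm_num
      · rw [h]; simp
    linarith
  rw [Real.sign_of_pos hv0, one_mul, lt_div_iff₀ (by positivity)] at hZ
  have hvm : v ^ 2 < m ^ 2 := by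
    have : v < m := by linarith
    nlinarith
  have h1 : ((1 + u) * Real.log (Real.sqrt D / δ) * 2) * normSq V⁻¹ w <
      normSq V⁻¹ S * normSq V⁻¹ w := by linarith
  have h2 := lt_of_mul_lt_mul_right h1 hb.le
  unfold auxM
  rw [← hDd]
  set N := normSq (V + (u * c) • (1 : Matrix (Fin k) (Fin k) ℝ))⁻¹ S with hN
  have h3 : (1 + u) * (Real.log (Real.sqrt D / δ) * 2) < (1 + u) * N := by linarith
  have h4 := lt_of_mul_lt_mul_left h3 (by positivity)
  have h5 : Real.log (Real.sqrt D / δ) < N / 2 := by linarith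
  have h6 := (Real.log_lt_iff_lt_exp hpos).1 h5
  rw [le_div_iff₀ (by linarith)]
  have : δ⁻¹ * Real.sqrt D = Real.sqrt D / δ := by ring
  linarith

/-- δ-correctness of the subspace (passive-learning) GLR stopping and
recommendation rules: for `θ ∈ U` and `P` whose rows form an orthonormal basis of `U`,
the recommended policy is ε-optimal with probability at least `1 − δ` on `{τ < ∞}`. -/
theorem stmt_14 [Nontrivial 𝒜]
    [MeasurableSpace 𝒳] [MeasurableSingletonClass 𝒳]
    [MeasurableSpace 𝒜] [MeasurableSingletonClass 𝒜]
    {Ω : Type*} [MeasureSpace Ω] [IsProbabilityMeasure (ℙ : Measure Ω)]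
    (φ : 𝒳 → 𝒜 → Fin d → ℝ) (θ : Fin d → ℝ)
    (rdim : ℕ) (U : Submodule ℝ (Fin d → ℝ)) (P : Matrix (Fin rdim) (Fin d) ℝ)
    (horth : ∀ i j, P i ⬝ᵥ P j = if i = j then (1 : ℝ) else 0)
    (hspanP : Submodule.span ℝ (Set.range fun i => P i) = U)
    (hθU : θ ∈ U)
    (p : Measure 𝒳) [IsProbabilityMeasure p]
    (X : ℕ → Ω → 𝒳) (act : ℕ → Ω → 𝒜) (ξ : ℕ → Ω → ℝ) (r : ℕ → Ω → ℝ)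
    (F : ℕ → MeasurableSpace Ω)
    (hF : ∀ t, F t =
      (⨆ s ∈ Finset.range t, MeasurableSpace.comap (X s) inferInstance) ⊔
      (⨆ s ∈ Finset.range t, MeasurableSpace.comap (act s) inferInstance) ⊔
      (⨆ s ∈ Finset.range t, MeasurableSpace.comap (r s) inferInstance))
    (hXmeas : ∀ t, Measurable (X t)) (hξmeas : ∀ t, Measurable (ξ t))
    (hXdist : ∀ t, Measure.map (X t) ℙ = p)
    (hXindep : ∀ t, Indep (MeasurableSpace.comap (X t) inferInstance) (F t) ℙ)
    (hact : ∀ t, Measurable[F t ⊔ MeasurableSpace.comap (X t) inferInstance] (act t))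
    (hξdist : ∀ t, Measure.map (ξ t) ℙ = gaussianReal 0 1)
    (hξindep : ∀ t, Indep (MeasurableSpace.comap (ξ t) inferInstance)
      (F t ⊔ MeasurableSpace.comap (X t) inferInstance ⊔
        MeasurableSpace.comap (act t) inferInstance) ℙ)
    (hr : ∀ t ω, r t ω = θ ⬝ᵥ φ (X t ω) (act t ω) + ξ t ω)
    (A : ℕ → Ω → Matrix (Fin d) (Fin d) ℝ)
    (hA : ∀ t ω, A t ω =
      ∑ s ∈ Finset.range t, vecMulVec (φ (X s ω) (act s ω)) (φ (X s ω) (act s ω)))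
    (θhatU : ℕ → Ω → Fin rdim → ℝ)
    (hθhatU : ∀ t ω, θhatU t ω =
      (P * A t ω * Pᵀ)⁻¹.mulVec (P.mulVec (∑ s ∈ Finset.range t, r s ω • φ (X s ω) (act s ω))))
    (ε δ u c : ℝ) (hε : 0 ≤ ε) (hδ : δ ∈ Set.Ioo (0 : ℝ) 1) (hu : 0 < u) (hc : 0 < c)
    (Z : ℕ → Ω → 𝒳 → 𝒜 → 𝒜 → ℝ)
    (hZ : ∀ t ω x a b, Z t ω x a b =
      Real.sign (θhatU t ω ⬝ᵥ P.mulVec (φ x a - φ x b) + ε) *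
        (θhatU t ω ⬝ᵥ P.mulVec (φ x a - φ x b) + ε) ^ 2 /
        (2 * normSq (P * A t ω * Pᵀ)⁻¹ (P.mulVec (φ x a - φ x b))))
    (β : ℕ → Ω → ℝ)
    (hβ : ∀ t ω, β t ω =
      (1 + u) * Real.log (Real.sqrt (((u * c)⁻¹ • (P * A t ω * Pᵀ) + 1).det) / δ))
    (S : Ω → Set ℕ)
    (hS : ∀ ω, S ω = {t | 1 ≤ t ∧
      (P * A t ω * Pᵀ - c • (1 : Matrix (Fin rdim) (Fin rdim) ℝ)).PosSemidef ∧
      ∀ x, ∃ a ∈ epsOpt (fun x a => P.mulVec (φ x a)) ε (θhatU t ω) x,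
        ∀ b ≠ a, β t ω < Z t ω x a b})
    (ahat : Ω → 𝒳 → 𝒜)
    (hahat : ∀ ω, (S ω).Nonempty → ∀ x,
      ahat ω x ∈ epsOpt (fun x a => P.mulVec (φ x a)) ε (θhatU (sInf (S ω)) ω) x ∧
      ∀ a ∈ epsOpt (fun x a => P.mulVec (φ x a)) ε (θhatU (sInf (S ω)) ω) x,
        (⨅ b : {b : 𝒜 // b ≠ a}, Z (sInf (S ω)) ω x a b.1) ≤
        ⨅ b : {b : 𝒜 // b ≠ ahat ω x}, Z (sInf (S ω)) ω x (ahat ω x) b.1) :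
    ℙ {ω | (S ω).Nonempty ∧ ∃ x, ε < gap φ θ x (ahat ω x)} ≤ ENNReal.ofReal δ := by
  have hFX : ∀ s t, s < t → Measurable[F t] (X s) := by
    intro s t hst
    rw [measurable_iff_comap_le, hF t]
    exact le_sup_of_le_left (le_sup_of_le_left
      (le_iSup₂_of_le s (Finset.mem_range.2 hst) le_rfl))
  have hFa : ∀ s t, s < t → Measurable[F t] (act s) := by
    intro s t hst
    rw [measurable_iff_comap_le, hF t]
    exact le_sup_of_le_left (le_sup_of_le_right
      (le_iSup₂_of_le s (Finset.mem_range.2 hst) le_rfl))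
  have hFr : ∀ s t, s < t → Measurable[F t] (r s) := by
    intro s t hst
    rw [measurable_iff_comap_le, hF t]
    exact le_sup_of_le_right (le_iSup₂_of_le s (Finset.mem_range.2 hst) le_rfl)
  have hmono : ∀ n, F n ≤ F (n + 1) := by
    intro n
    conv_lhs => rw [hF n]
    refine sup_le (sup_le ?_ ?_) ?_ <;> refine iSup₂_le fun s hs => ?_ <;>
      have hs' : s < n + 1 := (Finset.mem_range.1 hs).trans (Nat.lt_succ_self n)
    · exact (hFX s _ hs').comap_le
    · exact (hFa s _ hs').comap_le
    · exact (hFr s _ hs').comap_le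
  have hdisc : ∀ f : 𝒳 → 𝒜 → ℝ, Measurable fun p : 𝒳 × 𝒜 => f p.1 p.2 := fun f =>
    measurable_of_finite _
  have hFle : ∀ n, F n ≤ MeasureSpace.toMeasurableSpace := by
    intro n
    induction n with
    | zero => rw [hF 0]; simp
    | succ n ih =>
      have ha : Measurable (act n) :=
        (hact n).mono (sup_le ih (hXmeas n).comap_le) le_rfl
      have hrm : Measurable (r n) := by
        have : r n = fun ω => θ ⬝ᵥ φ (X n ω) (act n ω) + ξ n ω := funext (hr n)
        rw [this]
        exact ((hdisc fun x a => θ ⬝ᵥ φ x a).comp ((hXmeas n).prodMk ha)).add (hξmeas n)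
      conv_lhs => rw [hF (n + 1)]
      refine sup_le (sup_le ?_ ?_) ?_ <;> refine iSup₂_le fun s hs => ?_ <;>
        rcases Nat.lt_succ_iff_lt_or_eq.1 (Finset.mem_range.1 hs) with hs' | rfl
      · exact (hXmeas s).comap_le
      · exact (hXmeas s).comap_le
      · exact (hFa s _ hs').comap_le.trans ih
      · exact ha.comap_le
      · exact (hFr s _ hs').comap_le.trans ih
      · exact hrm.comap_le
  have hactm : ∀ n, Measurable (act n) := fun n => (hFa n (n+1) n.lt_succ_self).mono (hFle _) le_rfl
  obtain ⟨η, hη⟩ : ∃ η : Fin rdim → ℝ, ∀ v : Fin d → ℝ, θ ⬝ᵥ v = η ⬝ᵥ P *ᵥ v := by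
    rw [← hspanP, Submodule.mem_span_range_iff_exists_fun] at hθU
    obtain ⟨η, hη⟩ := hθU
    refine ⟨η, fun v => ?_⟩
    rw [← hη, sum_dotProduct]
    simp [dotProduct, mulVec, Finset.mul_sum, mul_assoc]
  set z : ℕ → Ω → Fin rdim → ℝ := fun s ω => P *ᵥ φ (X s ω) (act s ω) with hz
  have hV : ∀ t ω, P * A t ω * Pᵀ = ∑ s ∈ range t, vecMulVec (z s ω) (z s ω) := by
    intro t ω
    rw [hA, Matrix.mul_sum, Matrix.sum_mul]
    refine Finset.sum_congr rfl fun s _ => ?_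
    rw [mul_vecMulVec, vecMulVec_mul, vecMul_transpose]
  have hT : ∀ t ω, P *ᵥ (∑ s ∈ range t, r s ω • φ (X s ω) (act s ω)) =
      (∑ s ∈ range t, vecMulVec (z s ω) (z s ω)) *ᵥ η + ∑ s ∈ range t, ξ s ω • z s ω := by
    intro t ω
    rw [mulVec_sum, sum_mulVec, ← Finset.sum_add_distrib]
    refine Finset.sum_congr rfl fun s _ => ?_
    rw [mulVec_smul, vecMulVec_mulVec, hr, hη, dotProduct_comm]
    ext i
    simp [hz]
    ring
  have hmain := aux_main (ℙ : Measure Ω) F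
    (fun t => F t ⊔ MeasurableSpace.comap (X t) inferInstance ⊔
        MeasurableSpace.comap (act t) inferInstance) hmono
    (fun n => le_sup_of_le_left le_sup_left)
    (fun n => sup_le (sup_le (hFle n) (hXmeas n).comap_le) (hactm n).comap_le) ξ z
    (fun n i => (hdisc fun x a => (P *ᵥ φ x a) i).comp
      (Measurable.prodMk
        (measurable_iff_comap_le.2 (le_sup_of_le_left le_sup_right))
        (measurable_iff_comap_le.2 le_sup_right)))
    (fun n i => (hdisc fun x a => (P *ᵥ φ x a) i).comp
      (Measurable.prodMk (hFX n _ n.lt_succ_self) (hFa n _ n.lt_succ_self)))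
    (fun n => by
      have : ξ n = fun ω => r n ω - θ ⬝ᵥ φ (X n ω) (act n ω) := by
        funext ω; rw [hr]; ring
      rw [this]
      exact (hFr n _ n.lt_succ_self).sub ((hdisc fun x a => θ ⬝ᵥ φ x a).comp
        (Measurable.prodMk (hFX n _ n.lt_succ_self) (hFa n _ n.lt_succ_self))))
    hξdist hξindep (u * c) δ (mul_pos hu hc) hδ.1
  refine le_trans (measure_mono ?_) hmain
  rintro ω ⟨hne, x, hx⟩
  set t := sInf (S ω) with ht
  have htS : t ∈ S ω := Nat.sInf_mem hne
  rw [hS] at htS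
  obtain ⟨-, hps, hall⟩ := htS
  obtain ⟨a, haE, hab⟩ := hall x
  obtain ⟨-, hopt⟩ := hahat ω hne x
  obtain ⟨b, hb⟩ := exists_eq_ciSup_of_finite (f := fun a => θ ⬝ᵥ φ x a)
  have hgap : ε < θ ⬝ᵥ φ x b - θ ⬝ᵥ φ x (ahat ω x) := by
    have h := hx
    unfold gap maxVal at h
    rw [← hb] at h
    exact h
  have hbne : b ≠ ahat ω x := by
    intro h
    rw [h] at hgap
    linarith
  have hZb : β t ω < Z t ω x (ahat ω x) b := by
    obtain ⟨b0, hb0⟩ := exists_ne a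
    haveI : Nonempty {b : 𝒜 // b ≠ a} := ⟨⟨b0, hb0⟩⟩
    obtain ⟨b1, hb1⟩ := exists_eq_ciInf_of_finite (f := fun b : {b : 𝒜 // b ≠ a} => Z t ω x a b.1)
    calc β t ω < Z t ω x a b1.1 := hab b1.1 b1.2
      _ = ⨅ b : {b : 𝒜 // b ≠ a}, Z t ω x a b.1 := hb1
      _ ≤ ⨅ b : {b : 𝒜 // b ≠ ahat ω x}, Z t ω x (ahat ω x) b.1 := hopt a haE
      _ ≤ Z t ω x (ahat ω x) b :=
        ciInf_le (f := fun b : {b : 𝒜 // b ≠ ahat ω x} => Z t ω x (ahat ω x) b.1)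
          (Set.finite_range _).bddBelow ⟨b, hbne⟩
  rw [hβ, hZ, hθhatU, hT, hV] at hZb
  rw [hV] at hps
  refine ⟨t, aux_event hu hc hε hδ hps
    (aux_det_ge (mul_pos hu hc) (fun s => z s ω) t) η _ (P *ᵥ (φ x (ahat ω x) - φ x b)) ?_ hZb⟩
  rw [← hη, dotProduct_sub]
  linarith

end
end
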